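/- Let 0 < λ ≤ Λ and let F : 𝒮(n) → ℝ be (λ,Λ)-elliptic with F(0) = 0. If h ∈ C(B₁(0)) is a viscosity solution of F(D²h) = 0 in B₁(0), then there exist α ∈ (0,1) and c > 0, both depending only on n, λ, Λ, such that h ∈ C^{1,α}(B̄_{1/2}(0)) and ‖h‖_{C^{1,α}(B̄_{1/2}(0))} ≤ c‖h‖_{L∞(B₁(0))}. -/

import Mathlib

open Metric Set MeasureTheory Topology

noncomputable section

abbrev En (n : ℕ) : Type := EuclideanSpace ℝ (Fin n)
abbrev Mat (n : ℕ) : Type := Matrix (Fin n) (Fin n) ℝ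

/-- `F : 𝒮(n) → ℝ` is uniformly `(λ,Λ)`-elliptic:
for all symmetric `A, B` with `B` positive semidefinite,
`λ·tr B ≤ F A − F (A + B) ≤ Λ·tr B`. -/
def UniformlyElliptic {n : ℕ} (lam Lam : ℝ) (F : Mat n → ℝ) : Prop :=
  Continuous F ∧
    ∀ A B : Mat n, A.IsSymm → B.IsSymm → B.PosSemidef →
      lam * B.trace ≤ F A - F (A + B) ∧ F A - F (A + B) ≤ Lam * B.trace

/-- The Hessian matrix of `φ` at `x`, in the standard basis of `ℝⁿ`. -/
def hessianMatrix {n : ℕ} (φ : En n → ℝ) (x : En n) : Mat n :=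
  Matrix.of fun i j =>
    iteratedFDeriv ℝ 2 φ x ![EuclideanSpace.single i (1 : ℝ), EuclideanSpace.single j (1 : ℝ)]

/-- `w` is a viscosity subsolution of `G(x, u(x), Du, D²u) = 0` on `Ω`:
whenever a `C²` function `φ` is such that `w − φ` has a local maximum (on `Ω`) at `x₀ ∈ Ω`,
then `G x₀ (w x₀) (Dφ x₀) (D²φ x₀) ≤ 0`. -/
def ViscSubOn {n : ℕ} (Ω : Set (En n)) (G : En n → ℝ → En n → Mat n → ℝ)
    (w : En n → ℝ) : Prop :=
  ∀ φ : En n → ℝ, ContDiff ℝ 2 φ → ∀ x₀ ∈ Ω,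
    IsLocalMaxOn (fun x => w x - φ x) Ω x₀ →
      G x₀ (w x₀) (gradient φ x₀) (hessianMatrix φ x₀) ≤ 0

/-- `w` is a viscosity supersolution of `G(x, u(x), Du, D²u) = 0` on `Ω`. -/
def ViscSupOn {n : ℕ} (Ω : Set (En n)) (G : En n → ℝ → En n → Mat n → ℝ)
    (w : En n → ℝ) : Prop :=
  ∀ φ : En n → ℝ, ContDiff ℝ 2 φ → ∀ x₀ ∈ Ω,
    IsLocalMinOn (fun x => w x - φ x) Ω x₀ →
      0 ≤ G x₀ (w x₀) (gradient φ x₀) (hessianMatrix φ x₀)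

/-- viscosity solution: both a subsolution and a supersolution. -/
def ViscSolOn {n : ℕ} (Ω : Set (En n)) (G : En n → ℝ → En n → Mat n → ℝ)
    (u : En n → ℝ) : Prop :=
  ViscSubOn Ω G u ∧ ViscSupOn Ω G u

/-- `H(x, z; ξ) = |ξ+z|^p + coef(x)·|ξ+z|^e`. -/
def Hfun {n : ℕ} (p e : ℝ) (coef : En n → ℝ) (ξ x z : En n) : ℝ :=
  ‖ξ + z‖ ^ p + coef x * ‖ξ + z‖ ^ e

/-- The switched exponent `p_v(x) = p⁺·1_{v>0}(x) + p⁻·1_{v<0}(x)`. -/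
def pSwitch {n : ℕ} (pp pm : ℝ) (v : En n → ℝ) (x : En n) : ℝ :=
  pp * Set.indicator {y | 0 < v y} (fun _ => (1 : ℝ)) x
    + pm * Set.indicator {y | v y < 0} (fun _ => (1 : ℝ)) x

/-- The transmission operator
`[|ξ+z|^{p_v(x)} + a(x)1_{v>0}|ξ+z|^q + b(x)1_{v<0}|ξ+z|^s]·F(X) − f(x)`. -/
def transOp {n : ℕ} (F : Mat n → ℝ) (pp pm q s : ℝ) (a b f v : En n → ℝ) (ξ : En n) :
    En n → ℝ → En n → Mat n → ℝ :=
  fun x _ z X =>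
    (‖ξ + z‖ ^ pSwitch pp pm v x
        + a x * Set.indicator {y | 0 < v y} (fun _ => (1 : ℝ)) x * ‖ξ + z‖ ^ q
        + b x * Set.indicator {y | v y < 0} (fun _ => (1 : ℝ)) x * ‖ξ + z‖ ^ s) * F X - f x

/-- `min{F(X), H_q(x,z;ξ)F(X), H_s(x,z;ξ)F(X)} − rhs(x)`. -/
def minOp {n : ℕ} (F : Mat n → ℝ) (pp pm q s : ℝ) (a b : En n → ℝ) (ξ : En n)
    (rhs : En n → ℝ) : En n → ℝ → En n → Mat n → ℝ :=
  fun x _ z X =>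
    min (F X) (min (Hfun pp q a ξ x z * F X) (Hfun pm s b ξ x z * F X)) - rhs x

/-- `max{F(X), H_q(x,z;ξ)F(X), H_s(x,z;ξ)F(X)} − rhs(x)`. -/
def maxOp {n : ℕ} (F : Mat n → ℝ) (pp pm q s : ℝ) (a b : En n → ℝ) (ξ : En n)
    (rhs : En n → ℝ) : En n → ℝ → En n → Mat n → ℝ :=
  fun x _ z X =>
    max (F X) (max (Hfun pp q a ξ x z * F X) (Hfun pm s b ξ x z * F X)) - rhs x

/-- Definition D: `u` is a viscosity solution of the free transmission equation
relative to the sign of `v`, with translation vector `ξ`. -/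
def DefDSolution {n : ℕ} (Ω : Set (En n)) (F : Mat n → ℝ) (pp pm q s : ℝ)
    (a b f : En n → ℝ) (v : En n → ℝ) (ξ : En n) (u : En n → ℝ) : Prop :=
  ViscSolOn ({x ∈ Ω | 0 < v x} ∪ {x ∈ Ω | v x < 0}) (transOp F pp pm q s a b f v ξ) u ∧
  ViscSubOn {x ∈ Ω | v x = 0} (minOp F pp pm q s a b ξ f) u ∧
  ViscSupOn {x ∈ Ω | v x = 0} (maxOp F pp pm q s a b ξ f) u

/-- Uniform exterior sphere condition for `Ω`. -/
def UnifExtSphere {n : ℕ} (Ω : Set (En n)) : Prop :=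
  ∃ r : ℝ, 0 < r ∧ ∀ y ∈ frontier Ω, ∃ x : En n,
    dist y x = r ∧ Metric.closedBall x r ∩ closure Ω = {y}

/-- `φ` is a smooth, nonnegative, radially symmetric mollifier supported in `B_ε(0)`
with unit mass. -/
def IsMollifier {n : ℕ} (ε : ℝ) (φ : En n → ℝ) : Prop :=
  ContDiff ℝ (⊤ : ℕ∞) φ ∧ (∀ x, 0 ≤ φ x) ∧ (∀ x y : En n, ‖x‖ = ‖y‖ → φ x = φ y) ∧
    (∫ x, φ x) = 1 ∧ ∀ x : En n, ε ≤ ‖x‖ → φ x = 0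

/-- The mollified indicator `(φε * 1_S)(x)`. -/
def smoothedChi {n : ℕ} (φε : En n → ℝ) (S : Set (En n)) (x : En n) : ℝ :=
  ∫ y, φε y * S.indicator (fun _ => (1 : ℝ)) (x - y)

/-- `ℓ_μ(z) = √(μ² + |z|²)`. -/
def ellReg {n : ℕ} (μ : ℝ) (z : En n) : ℝ := Real.sqrt (μ ^ 2 + ‖z‖ ^ 2)

/-- The regularized operator
`G_ε(x, z)·(ε·r + F(X)) − f(x)`, where
`G_ε(x,z) = ℓ_ε(z)^{p_{ε;v}(x)} + a_{ε;v}(x) ℓ_ε(z)^q + b_{ε;v}(x) ℓ_ε(z)^s`. -/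
def regOp {n : ℕ} (F : Mat n → ℝ) (ε pp pm q s : ℝ) (a b v f φε : En n → ℝ) :
    En n → ℝ → En n → Mat n → ℝ :=
  fun x r z X =>
    (ellReg ε z ^ (ε + pp * smoothedChi φε {y | 0 < v y} x + pm * smoothedChi φε {y | v y < 0} x)
        + (ε + a x * smoothedChi φε {y | 0 < v y} x) * ellReg ε z ^ q
        + (ε + b x * smoothedChi φε {y | v y < 0} x) * ellReg ε z ^ s) * (ε * r + F X) - f x

/-- The Multi-Phase operator with variable exponents:
`[ℓ_μ(z)^{p(x)} + a(x)ℓ_μ(z)^{q(x)} + b(x)ℓ_μ(z)^{s(x)}]·(μ·r + F(X)) − f(x)`. -/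
def mpOp {n : ℕ} (F : Mat n → ℝ) (μ : ℝ) (p q s a b f : En n → ℝ) :
    En n → ℝ → En n → Mat n → ℝ :=
  fun x r z X =>
    (ellReg μ z ^ p x + a x * ellReg μ z ^ q x + b x * ellReg μ z ^ s x) * (μ * r + F X) - f x

/-- Pucci maximal operator `M⁺_{λ,Λ}(A) = −Λ·tr(A⁻) − λ·tr(A⁺)`. -/
def pucciPlus {n : ℕ} (lam Lam : ℝ) (A : Mat n) : ℝ :=
  if h : A.IsHermitian then
    -(Lam * ∑ i, min (h.eigenvalues i) 0) - lam * ∑ i, max (h.eigenvalues i) 0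
  else 0

/-- Pucci minimal operator `M⁻_{λ,Λ}(A) = −Λ·tr(A⁺) − λ·tr(A⁻)`. -/
def pucciMinus {n : ℕ} (lam Lam : ℝ) (A : Mat n) : ℝ :=
  if h : A.IsHermitian then
    -(Lam * ∑ i, max (h.eigenvalues i) 0) - lam * ∑ i, min (h.eigenvalues i) 0
  else 0

/-- `u` is locally `β`-Hölder continuous on `Ω`. -/
def LocallyHolderOn {n : ℕ} (Ω : Set (En n)) (β : ℝ) (u : En n → ℝ) : Prop :=
  ∀ x ∈ Ω, ∃ ε > 0, ∃ C : ℝ, ∀ y ∈ ball x ε ∩ Ω, ∀ z ∈ ball x ε ∩ Ω,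
    |u y - u z| ≤ C * ‖y - z‖ ^ β

/-- `u ∈ C^{1,α}_loc(Ω)`: `u` is differentiable on `Ω` with locally
`α`-Hölder continuous gradient. -/
def C1HolderLocOn {n : ℕ} (Ω : Set (En n)) (α : ℝ) (u : En n → ℝ) : Prop :=
  (∀ x ∈ Ω, DifferentiableAt ℝ u x) ∧
  ∀ x ∈ Ω, ∃ ε > 0, ∃ C : ℝ, ∀ y ∈ ball x ε ∩ Ω, ∀ z ∈ ball x ε ∩ Ω,
    ‖gradient u y - gradient u z‖ ≤ C * ‖y - z‖ ^ α

/-- abstract supersolution class -/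
def SupS {n : ℕ} (K : ℝ) (Ω : Set (En n)) (w : En n → ℝ) : Prop :=
  ∀ x ∈ Ω, ∀ p ν : En n, ∀ γ : ℝ, 0 ≤ γ →
    (∀ᶠ z in 𝓝 x, w x + inner ℝ p (z - x) + (inner ℝ ν (z - x)) ^ 2 - γ * ‖z - x‖ ^ 2 ≤ w z) →
    ‖ν‖ ^ 2 ≤ K * γ

theorem SupS.mono {n : ℕ} {K : ℝ} {Ω Ω' : Set (En n)} {w : En n → ℝ} (h : SupS K Ω w)
    (hs : Ω' ⊆ Ω) : SupS K Ω' w := fun x hx => h x (hs hx)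

theorem SupS.touch {n : ℕ} {K : ℝ} {Ω : Set (En n)} {w : En n → ℝ} (h : SupS K Ω w)
    {x : En n} (hx : x ∈ Ω) (p ν c₁ c₂ : En n) (γ : ℝ) (hγ : 0 ≤ γ)
    (ht : ∀ᶠ z in 𝓝 x, w x - (inner ℝ p x + (inner ℝ ν (x - c₁)) ^ 2 - γ * ‖x - c₂‖ ^ 2)
      ≤ w z - (inner ℝ p z + (inner ℝ ν (z - c₁)) ^ 2 - γ * ‖z - c₂‖ ^ 2)) :
    ‖ν‖ ^ 2 ≤ K * γ := by
  refine h x hx (p + (2 * inner ℝ ν (x - c₁)) • ν - (2 * γ) • (x - c₂)) ν γ hγ ?_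
  filter_upwards [ht] with z hz
  have e1 : z - c₁ = (z - x) + (x - c₁) := by abel
  have e2 : z - c₂ = (z - x) + (x - c₂) := by abel
  have e3 : inner ℝ p z = inner ℝ p (z - x) + inner ℝ p x := by
    rw [← inner_add_right]; congr 1; abel
  rw [e1, e2, e3, inner_add_right, norm_add_sq_real] at hz
  rw [inner_sub_left, inner_add_left, inner_smul_left, inner_smul_left,
    real_inner_comm (z - x) (x - c₂)]
  simp only [conj_trivial]
  nlinarith [hz]

theorem SupS.affine {n : ℕ} {K : ℝ} {Ω : Set (En n)} {w : En n → ℝ} (h : SupS K Ω w)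
    (x₀ : En n) (R c d : ℝ) (hR : 0 < R) (hc : 0 < c) :
    SupS K {x | x₀ + R • x ∈ Ω} (fun x => c * w (x₀ + R • x) + d) := by
  intro x hx p ν γ hγ ht
  have key := h (x₀ + R • x) hx ((1 / (c * R)) • p) ((1 / (Real.sqrt c * R)) • ν)
    (γ / (c * R ^ 2)) (by positivity) ?_
  · rw [norm_smul, mul_pow, Real.norm_eq_abs, sq_abs, div_pow, mul_pow, Real.sq_sqrt hc.le] at key
    have hp : 0 < c * R ^ 2 := by positivity
    have e : (1 ^ 2 / (c * R ^ 2)) * ‖ν‖ ^ 2 = ‖ν‖ ^ 2 / (c * R ^ 2) := by ring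
    rw [e, ← mul_div_assoc, div_le_div_iff_of_pos_right hp] at key
    exact key
  · have hcont : Filter.Tendsto (fun z : En n => (1 / R) • (z - x₀)) (𝓝 (x₀ + R • x)) (𝓝 x) := by
      have : ContinuousAt (fun z : En n => (1 / R) • (z - x₀)) (x₀ + R • x) := by fun_prop
      have e : (1 / R) • (x₀ + R • x - x₀) = x := by
        rw [add_sub_cancel_left, smul_smul, one_div_mul_cancel hR.ne', one_smul]
      rw [ContinuousAt, e] at this
      exact this
    filter_upwards [hcont.eventually ht] with z hz
    have e0 : x₀ + R • ((1 / R) • (z - x₀)) = z := by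
      rw [smul_smul, mul_one_div_cancel hR.ne', one_smul]; abel
    have e1 : (1 / R) • (z - x₀) - x = (1 / R) • (z - (x₀ + R • x)) := by
      rw [← sub_sub z x₀, smul_sub (1 / R) (z - x₀), smul_smul, one_div_mul_cancel hR.ne', one_smul]
    rw [e0, e1] at hz
    set ζ := z - (x₀ + R • x)
    rw [inner_smul_right, inner_smul_right, norm_smul, Real.norm_eq_abs, mul_pow |1 / R|, sq_abs] at hz
    rw [inner_smul_left, inner_smul_left]
    simp only [conj_trivial]
    have hs := Real.sq_sqrt hc.le
    have e2 : (1 / (Real.sqrt c * R) * inner ℝ ν ζ) ^ 2 = (1 / R * inner ℝ ν ζ) ^ 2 / c := by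
      rw [mul_pow, mul_pow, div_pow, mul_pow, hs, div_pow]; field_simp
    rw [e2]
    have : c * w (x₀ + R • x) + (1 / R * inner ℝ p ζ) + (1 / R * inner ℝ ν ζ) ^ 2
      - γ * ((1 / R) ^ 2 * ‖ζ‖ ^ 2) ≤ c * w z := by linarith
    have := div_le_div_of_nonneg_right this hc.le
    rw [mul_div_cancel_left₀ _ hc.ne'] at this
    refine le_trans (le_of_eq ?_) this
    field_simp

theorem lip_measure {n : ℕ} (C : NNReal) (f : En n → En n) (s : Set (En n))
    (h : LipschitzOnWith C f s) : volume (f '' s) ≤ (C : ENNReal) ^ n * volume s := by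
  have h1 := h.hausdorffMeasure_image_le (d := n) (by positivity)
  have : (Measure.hausdorffMeasure (n : ℝ) : Measure (En n)).IsAddHaarMeasure := by
    simpa using MeasureTheory.isAddHaarMeasure_hausdorffMeasure (E := EuclideanSpace ℝ (Fin n))
  obtain e := Measure.isAddLeftInvariant_eq_smul (volume : Measure (En n))
    (Measure.hausdorffMeasure (n : ℝ))
  rw [e, Measure.smul_apply, Measure.smul_apply, ENNReal.smul_def, ENNReal.smul_def, smul_eq_mul,
    smul_eq_mul, mul_left_comm]
  gcongr
  simpa using h1

set_option maxHeartbeats 1000000 in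
theorem vertex_lip {n : ℕ} {K : ℝ} (hK : 1 ≤ K) {Ω : Set (En n)} {w : En n → ℝ} (h : SupS K Ω w)
    (x₀ x₁ y₀ y₁ : En n) (a r : ℝ) (ha : 0 < a) (hr : 0 < r) (hxr : ‖x₀ - x₁‖ ≤ r)
    (hsub : closedBall x₀ (5 * K * r) ⊆ Ω) (hc : ContinuousOn w Ω)
    (h0 : ∀ z ∈ closedBall x₀ (5 * K * r), w x₀ + a / 2 * ‖x₀ - y₀‖ ^ 2 ≤ w z + a / 2 * ‖z - y₀‖ ^ 2)
    (h1 : ∀ z ∈ closedBall x₀ (5 * K * r), w x₁ + a / 2 * ‖x₁ - y₁‖ ^ 2 ≤ w z + a / 2 * ‖z - y₁‖ ^ 2) :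
    ‖y₀ - y₁‖ ≤ 9 * K * r := by
  by_contra hcon
  push Not at hcon
  set q : En n := a • (y₁ - y₀) with hq
  have hqn : ‖q‖ = a * ‖y₀ - y₁‖ := by
    rw [hq, norm_smul, Real.norm_eq_abs, abs_of_pos ha, norm_sub_rev]
  have hqK : 9 * K * a * r < ‖q‖ := by rw [hqn]; have := mul_lt_mul_of_pos_left hcon ha; linarith
  have hqpos : 0 < ‖q‖ := lt_trans (by positivity) hqK
  set ν : En n := (1 / ‖q‖) • q with hν
  have hνn : ‖ν‖ = 1 := by
    rw [hν, norm_smul, Real.norm_eq_abs, abs_of_pos (by positivity)]; field_simp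
  have hqν : q = ‖q‖ • ν := by
    rw [hν, smul_smul, mul_one_div_cancel hqpos.ne', one_smul]
  -- g
  set g : En n → ℝ := fun z => w z + a / 2 * ‖z - y₀‖ ^ 2 - (w x₀ + a / 2 * ‖x₀ - y₀‖ ^ 2) with hg
  have hKr : r ≤ 5 * K * r := by nlinarith
  have hx₁mem : x₁ ∈ closedBall x₀ (5 * K * r) := by
    rw [mem_closedBall, dist_comm, dist_eq_norm]; linarith
  have hg0 : ∀ z ∈ closedBall x₀ (5 * K * r), 0 ≤ g z := by
    intro z hz; have := h0 z hz; simp only [hg]; linarith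
  have hg1 : ∀ z ∈ closedBall x₀ (5 * K * r), ‖q‖ * (inner ℝ ν (z - x₀) - r) ≤ g z := by
    intro z hz
    have e1 := h1 z hz
    have e2 := hg0 x₁ hx₁mem
    simp only [hg] at e2 ⊢
    have e3 : a / 2 * ‖z - y₀‖ ^ 2 - a / 2 * ‖x₁ - y₀‖ ^ 2 - (a / 2 * ‖z - y₁‖ ^ 2 - a / 2 * ‖x₁ - y₁‖ ^ 2)
        = inner ℝ q (z - x₁) := by
      have s1 : z - y₀ = (z - x₁) + (x₁ - y₀) := by abel
      have s2 : z - y₁ = (z - x₁) + (x₁ - y₁) := by abel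
      rw [s1, s2, norm_add_sq_real, norm_add_sq_real, hq, inner_smul_left]
      have s3 : inner ℝ (y₁ - y₀) (z - x₁) = inner ℝ (z - x₁) (x₁ - y₀) - inner ℝ (z - x₁) (x₁ - y₁) := by
        rw [← inner_sub_right, real_inner_comm]; congr 1; abel
      simp only [conj_trivial]
      rw [s3]; ring
    have e4 : inner ℝ q (z - x₁) = ‖q‖ * (inner ℝ ν (z - x₀) + inner ℝ ν (x₀ - x₁)) := by
      rw [← inner_add_right]
      conv_lhs => rw [hqν, inner_smul_left]
      simp
    have e5 : -r ≤ inner ℝ ν (x₀ - x₁) := by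
      have := abs_real_inner_le_norm ν (x₀ - x₁)
      rw [hνn, one_mul] at this
      have := (abs_le.1 this).1
      linarith
    have e6 := mul_le_mul_of_nonneg_left e5 hqpos.le
    linarith
  clear_value ν q
  set c : ℝ := ‖q‖ / (9 * r) with hcdef
  have hcpos : 0 < c := by positivity
  have hcr : c * (9 * r) = ‖q‖ := by rw [hcdef]; field_simp
  set γ : ℝ := 1 / (2 * K) with hγ
  have hγpos : 0 < γ := by positivity
  have hγK : K * γ = 1 / 2 := by rw [hγ]; field_simp
  set ψ : En n → ℝ := fun z => c * ((inner ℝ ν (z - x₀) + r) ^ 2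
    - γ * (‖z - x₀‖ ^ 2 - (inner ℝ ν (z - x₀)) ^ 2)) with hψ
  set S : Set (En n) := closedBall x₀ (5 * K * r) ∩
    {z | -r ≤ inner ℝ ν (z - x₀) ∧ inner ℝ ν (z - x₀) ≤ 2 * r} with hS
  have hcontinner : Continuous fun z : En n => (inner ℝ ν (z - x₀) : ℝ) := by fun_prop
  have hSc : IsCompact S := by
    apply (isCompact_closedBall _ _).inter_right
    exact (isClosed_le continuous_const hcontinner).inter (isClosed_le hcontinner continuous_const)
  have hx₀S : x₀ ∈ S := by
    refine ⟨mem_closedBall_self (by positivity), ?_⟩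
    simp only [mem_ofPred_eq, sub_self, inner_zero_right]; constructor <;> linarith
  have hcw : ContinuousOn (fun z => g z - ψ z) S := by
    have : ContinuousOn w S := hc.mono (fun z hz => hsub hz.1)
    simp only [hg, hψ]
    fun_prop
  obtain ⟨z, hzS, hzmin⟩ := hSc.exists_isMinOn ⟨x₀, hx₀S⟩ hcw
  have hneg : g z - ψ z < 0 := by
    have h1 : g z - ψ z ≤ g x₀ - ψ x₀ := hzmin hx₀S
    have h2 : g x₀ = 0 := by simp [hg]
    have h3 : ψ x₀ = c * r ^ 2 := by simp [hψ]
    have : 0 < c * r ^ 2 := by positivity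
    linarith
  have hCS : ∀ z : En n, (inner ℝ ν (z - x₀)) ^ 2 ≤ ‖z - x₀‖ ^ 2 := by
    intro z
    have := abs_real_inner_le_norm ν (z - x₀)
    rw [hνn, one_mul] at this
    exact sq_le_sq' (abs_le.1 this).1 (abs_le.1 this).2
  set t : ℝ := inner ℝ ν (z - x₀) with ht
  have hψz : ψ z = c * ((t + r) ^ 2 - γ * (‖z - x₀‖ ^ 2 - t ^ 2)) := rfl
  have hperp : 0 ≤ γ * (‖z - x₀‖ ^ 2 - t ^ 2) := mul_nonneg hγpos.le (by linarith [hCS z])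
  have hgz := hg0 z hzS.1
  have t1 : -r < t := by
    rcases hzS.2.1.lt_or_eq with h' | h'
    · exact h'
    · exfalso
      have : t + r = 0 := by rw [ht]; linarith
      rw [hψz, this] at hneg
      have := mul_nonneg hcpos.le hperp
      linarith
  have t2 : t < 2 * r := by
    rcases hzS.2.2.lt_or_eq with h' | h'
    · exact h'
    · exfalso
      have e : t = 2 * r := h'
      have := hg1 z hzS.1
      rw [← ht, e] at this
      rw [hψz, e] at hneg
      rw [e] at hperp
      have : c * ((2 * r + r) ^ 2) = ‖q‖ * r := by rw [← hcr]; ring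
      have := mul_nonneg hcpos.le hperp
      linarith
  have t3 : ‖z - x₀‖ < 5 * K * r := by
    have hz1 := hzS.1
    rw [mem_closedBall, dist_eq_norm] at hz1
    rcases hz1.lt_or_eq with h' | h'
    · exact h'
    · exfalso
      rw [hψz, h'] at hneg
      have a1 : (t + r) ^ 2 ≤ (3 * r) ^ 2 := pow_le_pow_left₀ (by linarith) (by linarith) 2
      have a2 : t ^ 2 ≤ (2 * r) ^ 2 := sq_le_sq' (by linarith) (by linarith)
      have a3 : 9 * r ^ 2 ≤ γ * ((5 * K * r) ^ 2 - t ^ 2) := by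
        have : (18 * K) * r ^ 2 ≤ (5 * K * r) ^ 2 - t ^ 2 := by
          have : (18 * K + 4) * r ^ 2 ≤ 25 * K ^ 2 * r ^ 2 := by
            apply mul_le_mul_of_nonneg_right _ (by positivity)
            nlinarith only [hK]
          linarith
        calc 9 * r ^ 2 = γ * (18 * K * r ^ 2) := by
              rw [show γ * (18 * K * r ^ 2) = (K * γ) * 18 * r ^ 2 by ring, hγK]; ring
          _ ≤ _ := mul_le_mul_of_nonneg_left this hγpos.le
      have a4 := mul_nonneg hcpos.le (show 0 ≤ γ * ((5 * K * r) ^ 2 - t ^ 2) - (t + r) ^ 2 by linarith)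
      linarith
  have hnear : ∀ᶠ z' in 𝓝 z, z' ∈ S := by
    have o1 : ∀ᶠ z' in 𝓝 z, z' ∈ closedBall x₀ (5 * K * r) := by
      apply closedBall_mem_nhds_of_mem
      rw [mem_ball, dist_eq_norm]; exact t3
    have o2 : ∀ᶠ z' in 𝓝 z, -r < inner ℝ ν (z' - x₀) :=
      hcontinner.continuousAt.eventually (lt_mem_nhds t1)
    have o3 : ∀ᶠ z' in 𝓝 z, inner ℝ ν (z' - x₀) < 2 * r :=
      hcontinner.continuousAt.eventually (gt_mem_nhds t2)
    filter_upwards [o1, o2, o3] with z' h1 h2 h3 using ⟨h1, h2.le, h3.le⟩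
  have key := h.touch (hsub hzS.1) ((2 * c * r) • ν + a • (y₀ - x₀)) (Real.sqrt (c * (1 + γ)) • ν) x₀ x₀
    (c * γ + a / 2) (by positivity) ?_
  · rw [norm_smul, hνn, mul_one, Real.norm_eq_abs, sq_abs, Real.sq_sqrt (by positivity)] at key
    have : c ≤ K * a := by
      have := mul_pos hcpos hγpos
      have e : K * (c * γ + a / 2) = c * (K * γ) + K * a / 2 := by ring
      rw [e, hγK] at key
      linarith
    have : ‖q‖ ≤ 9 * K * a * r := by
      rw [← hcr]
      have := mul_le_mul_of_nonneg_right this (show 0 ≤ 9 * r by positivity)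
      linarith
    linarith
  · filter_upwards [hnear] with z' hz'
    have hm : g z - ψ z ≤ g z' - ψ z' := hzmin hz'
    have ex : ∀ v : En n, inner ℝ ((2 * c * r) • ν + a • (y₀ - x₀)) v
        + (inner ℝ (Real.sqrt (c * (1 + γ)) • ν) (v - x₀)) ^ 2 - (c * γ + a / 2) * ‖v - x₀‖ ^ 2
        = ψ v - a / 2 * ‖v - y₀‖ ^ 2 + (inner ℝ ((2 * c * r) • ν + a • (y₀ - x₀)) x₀ - c * r ^ 2
          + a / 2 * ‖x₀ - y₀‖ ^ 2) := by
      intro v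
      have s1 : v - y₀ = (v - x₀) + (x₀ - y₀) := by abel
      have s2 : inner ℝ ((2 * c * r) • ν + a • (y₀ - x₀)) v
        = inner ℝ ((2 * c * r) • ν + a • (y₀ - x₀)) (v - x₀) + inner ℝ ((2 * c * r) • ν + a • (y₀ - x₀)) x₀ := by
        rw [← inner_add_right]; congr 1; abel
      have s3 : inner ℝ (y₀ - x₀) (v - x₀) = - inner ℝ (v - x₀) (x₀ - y₀) := by
        rw [real_inner_comm, ← inner_neg_right]; congr 1; abel
      rw [s2, s1, norm_add_sq_real, inner_add_left (_ • ν), inner_smul_left, inner_smul_left,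
        inner_smul_left]
      simp only [conj_trivial, hψ]
      rw [mul_pow, Real.sq_sqrt (by positivity), s3]
      ring
    rw [ex, ex]
    simp only [hg] at hm
    linarith

theorem exp_quad {s : ℝ} (hs : -2 ≤ s) : 1 + s + s ^ 2 / 4 ≤ Real.exp s := by
  have h1 : s / 2 + 1 ≤ Real.exp (s / 2) := Real.add_one_le_exp _
  have h2 : Real.exp s = Real.exp (s / 2) ^ 2 := by
    rw [← Real.exp_nat_mul]; congr 1; push_cast; ring
  rw [h2]
  calc 1 + s + s ^ 2 / 4 = (s / 2 + 1) ^ 2 := by ring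
    _ ≤ _ := pow_le_pow_left₀ (by linarith) h1 2

set_option maxHeartbeats 1000000 in
theorem barrier {n : ℕ} {K : ℝ} (hK : 1 ≤ K) {Ω : Set (En n)} {w : En n → ℝ} (h : SupS K Ω w)
    (hc : ContinuousOn w Ω) (x₀ x₁ y : En n) (a r : ℝ) (ha : 0 < a) (hr : 0 < r)
    (hsub : closedBall x₁ (2 * r) ⊆ Ω) (hx : ‖x₀ - x₁‖ ≤ r)
    (h0 : ∀ z ∈ closedBall x₁ (2 * r), w x₀ + a / 2 * ‖x₀ - y‖ ^ 2 ≤ w z + a / 2 * ‖z - y‖ ^ 2) :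
    ∃ x₂ ∈ closedBall x₁ (r / 16), w x₂ + a / 2 * ‖x₂ - y‖ ^ 2 - (w x₀ + a / 2 * ‖x₀ - y‖ ^ 2)
      ≤ Real.exp (8192 * K) * a * r ^ 2 := by
  by_contra hcon
  push Not at hcon
  set g : En n → ℝ := fun z => w z + a / 2 * ‖z - y‖ ^ 2 - (w x₀ + a / 2 * ‖x₀ - y‖ ^ 2) with hg
  set β : ℝ := 2048 * K with hβ
  have hβpos : 0 < β := by positivity
  set κ : ℝ := Real.exp (8192 * K) with hκ
  have hκ4 : κ * Real.exp (-(4 * β)) = 1 := by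
    rw [hκ, ← Real.exp_add, hβ, show 8192 * K + -(4 * (2048 * K)) = 0 by ring, Real.exp_zero]
  have hκpos : 0 < κ := Real.exp_pos _
  set b : En n → ℝ := fun z => κ * a * r ^ 2 * (Real.exp (-(β / r ^ 2 * ‖z - x₁‖ ^ 2)) - Real.exp (-(4 * β)))
    with hb
  have hcw : ContinuousOn (fun z => g z - b z) (closedBall x₁ (2 * r)) := by
    have : ContinuousOn w (closedBall x₁ (2 * r)) := hc.mono hsub
    simp only [hg, hb]
    fun_prop
  have hx₀ : x₀ ∈ closedBall x₁ (2 * r) := by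
    rw [mem_closedBall, dist_eq_norm]; linarith
  obtain ⟨z, hzS, hzmin⟩ := (isCompact_closedBall x₁ (2 * r)).exists_isMinOn ⟨x₀, hx₀⟩ hcw
  have hA : 0 < κ * a * r ^ 2 := by positivity
  have hneg : g z - b z < 0 := by
    have h1 : g z - b z ≤ g x₀ - b x₀ := hzmin hx₀
    have h2 : g x₀ = 0 := by simp [hg]
    have h3 : 0 < b x₀ := by
      apply mul_pos hA
      rw [sub_pos, Real.exp_lt_exp, neg_lt_neg_iff]
      have : ‖x₀ - x₁‖ ^ 2 ≤ r ^ 2 := pow_le_pow_left₀ (norm_nonneg _) hx 2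
      calc β / r ^ 2 * ‖x₀ - x₁‖ ^ 2 ≤ β / r ^ 2 * r ^ 2 := by gcongr
        _ = β := by field_simp
        _ < _ := by linarith
    linarith
  set d : En n := z - x₁ with hd
  have d1 : r / 16 < ‖d‖ := by
    by_contra hh
    push Not at hh
    have h1 := hcon z (by rw [mem_closedBall, dist_eq_norm]; exact hh)
    have h2 : b z ≤ κ * a * r ^ 2 := by
      have e1 : Real.exp (-(β / r ^ 2 * ‖z - x₁‖ ^ 2)) ≤ 1 := by
        rw [Real.exp_le_one_iff]
        have : 0 ≤ β / r ^ 2 * ‖z - x₁‖ ^ 2 := by positivity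
        linarith
      have e2 := Real.exp_pos (-(4 * β))
      have := mul_le_mul_of_nonneg_left (show Real.exp (-(β / r ^ 2 * ‖z - x₁‖ ^ 2)) - Real.exp (-(4 * β)) ≤ 1 by linarith) hA.le
      simp only [hb]; linarith
    simp only [hg] at hneg
    linarith
  have d2 : ‖d‖ < 2 * r := by
    rw [mem_closedBall, dist_eq_norm] at hzS
    rcases hzS.lt_or_eq with h' | h'
    · exact h'
    · exfalso
      have h1 := h0 z (by rw [mem_closedBall, dist_eq_norm]; exact h'.le)
      have h2 : b z = 0 := by
        simp only [hb]
        rw [h', show β / r ^ 2 * (2 * r) ^ 2 = 4 * β by field_simp; ring, sub_self, mul_zero]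
      simp only [hg] at hneg
      linarith
  have hE1 : Real.exp (-(4 * β)) ≤ Real.exp (-(β / r ^ 2 * ‖d‖ ^ 2)) := by
    rw [Real.exp_le_exp, neg_le_neg_iff]
    have : ‖d‖ ^ 2 ≤ (2 * r) ^ 2 := pow_le_pow_left₀ (norm_nonneg _) d2.le 2
    calc β / r ^ 2 * ‖d‖ ^ 2 ≤ β / r ^ 2 * (2 * r) ^ 2 := by gcongr
        _ = 4 * β := by field_simp; ring
  set E : ℝ := Real.exp (-(β / r ^ 2 * ‖d‖ ^ 2)) with hE
  have hEpos : 0 < E := Real.exp_pos _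
  set T : ℝ := κ * a * E * β with hT
  have hTpos : 0 < T := by positivity
  have hTa : a * β ≤ T := by
    have : 1 ≤ κ * E := by rw [← hκ4]; gcongr
    have := mul_le_mul_of_nonneg_right this (show 0 ≤ a * β by positivity)
    rw [hT]; linarith
  have key := h z (hsub hzS) (-(2 * T) • d - a • (z - y)) (Real.sqrt (T * β / (2 * r ^ 2)) • d)
    (2 * T + a / 2) (by positivity) ?_
  · rw [norm_smul, mul_pow, Real.norm_eq_abs, sq_abs, Real.sq_sqrt (by positivity)] at key
    have h1 : r ^ 2 / 256 ≤ ‖d‖ ^ 2 := by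
      have := pow_le_pow_left₀ (by positivity) d1.le 2
      linarith
    have h2 : T * β / (2 * r ^ 2) * (r ^ 2 / 256) ≤ T * β / (2 * r ^ 2) * ‖d‖ ^ 2 := by gcongr
    have h3 : T * β / (2 * r ^ 2) * (r ^ 2 / 256) = 4 * (K * T) := by
      rw [hβ]; field_simp; ring
    have h4 : K * T ≤ K * (a / 4) := by linarith
    have h5 : T ≤ a / 4 := le_of_mul_le_mul_left h4 (by linarith)
    have h6 : a * 1 ≤ a * β := by gcongr; rw [hβ]; linarith
    linarith
  · have c1 : ∀ᶠ z' in 𝓝 z, z' ∈ closedBall x₁ (2 * r) := by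
      apply closedBall_mem_nhds_of_mem
      rw [mem_ball, dist_eq_norm]; exact d2
    have c2 : ∀ᶠ z' in 𝓝 z, -2 < -(β / r ^ 2 * (2 * inner ℝ d (z' - z) + ‖z' - z‖ ^ 2)) := by
      have : ContinuousAt (fun z' : En n => -(β / r ^ 2 * (2 * inner ℝ d (z' - z) + ‖z' - z‖ ^ 2))) z := by
        fun_prop
      apply this.eventually (lt_mem_nhds _)
      simp
    have c3 : ∀ᶠ z' in 𝓝 z, β / r ^ 2 * ‖z' - z‖ ^ 2 < 4 := by
      have : ContinuousAt (fun z' : En n => β / r ^ 2 * ‖z' - z‖ ^ 2) z := by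
        fun_prop
      apply this.eventually (gt_mem_nhds _)
      simp
    filter_upwards [c1, c2, c3] with z' h1 h2 h3
    have hm : g z - b z ≤ g z' - b z' := hzmin h1
    set ζ := z' - z with hζ
    have hz'd : ‖z' - x₁‖ ^ 2 = ‖d‖ ^ 2 + 2 * inner ℝ d ζ + ‖ζ‖ ^ 2 := by
      rw [← norm_add_sq_real]; congr 2; rw [hd, hζ]; abel
    have hz'y : ‖z' - y‖ ^ 2 = ‖z - y‖ ^ 2 + 2 * inner ℝ (z - y) ζ + ‖ζ‖ ^ 2 := by
      rw [← norm_add_sq_real]; congr 2; rw [hζ]; abel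
    set s := -(β / r ^ 2 * (2 * inner ℝ d ζ + ‖ζ‖ ^ 2)) with hs
    have hbb : b z' - b z = κ * a * r ^ 2 * E * (Real.exp s - 1) := by
      simp only [hb]
      rw [hz'd, show -(β / r ^ 2 * (‖d‖ ^ 2 + 2 * inner ℝ d ζ + ‖ζ‖ ^ 2)) =
        -(β / r ^ 2 * ‖d‖ ^ 2) + s by rw [hs]; ring, Real.exp_add, ← hE]
      ring
    have hexp := exp_quad h2.le
    set m := β / r ^ 2 with hm'
    have hmpos : 0 < m := by positivity
    have q1 : m ^ 2 * (inner ℝ d ζ) ^ 2 / 2 - m * ‖ζ‖ ^ 2 ≤ s ^ 2 / 4 := by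
      have e : s ^ 2 / 4 = m ^ 2 * (inner ℝ d ζ + ‖ζ‖ ^ 2 / 2) ^ 2 := by rw [hs]; ring
      rw [e]
      have e2 : (inner ℝ d ζ) ^ 2 / 2 - ‖ζ‖ ^ 4 / 4 ≤ (inner ℝ d ζ + ‖ζ‖ ^ 2 / 2) ^ 2 := by
        nlinarith only [sq_nonneg (inner ℝ d ζ + ‖ζ‖ ^ 2)]
      have e3 := mul_le_mul_of_nonneg_left e2 (sq_nonneg m)
      have e4 := mul_le_mul_of_nonneg_left h3.le (show 0 ≤ m * ‖ζ‖ ^ 2 / 4 by positivity)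
      have e5 : m * ‖ζ‖ ^ 2 / 4 * (m * ‖ζ‖ ^ 2) = m ^ 2 * (‖ζ‖ ^ 4 / 4) := by ring
      linarith
    have q2 : -(2 * m) * inner ℝ d ζ - 2 * m * ‖ζ‖ ^ 2 + m ^ 2 / 2 * (inner ℝ d ζ) ^ 2
        ≤ Real.exp s - 1 := by
      have : s = -(2 * m) * inner ℝ d ζ - m * ‖ζ‖ ^ 2 := by rw [hs]; ring
      linarith
    have q3 := mul_le_mul_of_nonneg_left q2 (show 0 ≤ κ * a * r ^ 2 * E by positivity)
    rw [← hbb] at q3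
    have q4 : κ * a * r ^ 2 * E * (-(2 * m) * inner ℝ d ζ - 2 * m * ‖ζ‖ ^ 2 + m ^ 2 / 2 * (inner ℝ d ζ) ^ 2)
        = -(2 * T) * inner ℝ d ζ - 2 * T * ‖ζ‖ ^ 2 + T * β / (2 * r ^ 2) * (inner ℝ d ζ) ^ 2 := by
      rw [hT, hm']; field_simp
    rw [inner_sub_left, inner_smul_left, inner_smul_left, inner_smul_left, mul_pow]
    simp only [conj_trivial]
    rw [Real.sq_sqrt (by positivity)]
    simp only [hg] at hm
    rw [hz'y] at hm
    rw [q4] at q3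
    linarith

theorem combine {n : ℕ} (a b : ℝ) (ha : 0 < a) (hb : 0 < b) (y y' z : En n) :
    a / 2 * ‖z - y‖ ^ 2 + b / 2 * ‖z - y'‖ ^ 2 =
      (a + b) / 2 * ‖z - (1 / (a + b)) • (a • y + b • y')‖ ^ 2
        + a * b / (2 * (a + b)) * ‖y - y'‖ ^ 2 := by
  have hab : a + b ≠ 0 := by positivity
  have e1 : z - (1 / (a + b)) • (a • y + b • y') = (1 / (a + b)) • (a • (z - y) + b • (z - y')) := by
    have : z = (1 / (a + b)) • ((a + b) • z) := by
      rw [smul_smul, one_div_mul_cancel hab, one_smul]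
    nth_rewrite 1 [this]
    rw [← smul_sub]; congr 1
    rw [add_smul, smul_sub, smul_sub]; abel
  have e2 : y - y' = (z - y') - (z - y) := by abel
  rw [e1, e2, norm_smul, mul_pow, Real.norm_eq_abs, sq_abs, norm_add_sq_real, norm_sub_sq_real (z - y') (z - y),
    norm_smul, norm_smul, inner_smul_left, inner_smul_right, mul_pow, mul_pow, Real.norm_eq_abs,
    Real.norm_eq_abs, sq_abs, sq_abs, real_inner_comm (z - y) (z - y')]
  simp only [conj_trivial]
  field_simp
  ring

/-- contact set -/
def Ct {n : ℕ} (w : En n → ℝ) (a : ℝ) : Set (En n) :=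
  {x | x ∈ closedBall 0 1 ∧ ∃ y ∈ closedBall (0 : En n) 1, ∀ z ∈ closedBall (0 : En n) 1,
    w x + a / 2 * ‖x - y‖ ^ 2 ≤ w z + a / 2 * ‖z - y‖ ^ 2}

theorem conv_mem {n : ℕ} (a b : ℝ) (ha : 0 < a) (hb : 0 < b) {y y' : En n}
    (hy : y ∈ closedBall (0 : En n) 1) (hy' : y' ∈ closedBall (0 : En n) 1) :
    (1 / (a + b)) • (a • y + b • y') ∈ closedBall (0 : En n) 1 := by
  rw [mem_closedBall_zero_iff] at *
  rw [norm_smul, Real.norm_eq_abs, abs_of_pos (by positivity)]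
  have : ‖a • y + b • y'‖ ≤ a * 1 + b * 1 := by
    refine (norm_add_le _ _).trans ?_
    rw [norm_smul, norm_smul, Real.norm_eq_abs, Real.norm_eq_abs, abs_of_pos ha, abs_of_pos hb]
    gcongr
  rw [div_mul_eq_mul_div, one_mul, div_le_one (by positivity)]
  linarith

theorem Ct_mono {n : ℕ} (w : En n → ℝ) (a b : ℝ) (ha : 0 < a) (hb : 0 < b) :
    Ct w a ⊆ Ct w (a + b) := by
  rintro x ⟨hx, y, hy, h⟩
  refine ⟨hx, _, conv_mem a b ha hb hy hx, fun z hz => ?_⟩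
  have h1 := combine a b ha hb y x x
  have h2 := combine a b ha hb y x z
  have := h z hz
  have h3 : 0 ≤ b / 2 * ‖z - x‖ ^ 2 := by positivity
  simp only [sub_self, norm_zero] at h1
  linarith

theorem Ct_closed {n : ℕ} (w : En n → ℝ) (a : ℝ) (hw : ContinuousOn w (closedBall 0 1)) :
    IsClosed (Ct w a) := by
  have hC : IsCompact ({q : En n × En n | q ∈ closedBall (0 : En n) 1 ×ˢ closedBall (0 : En n) 1 ∧
      ∀ z ∈ closedBall (0 : En n) 1, w q.1 + a / 2 * ‖q.1 - q.2‖ ^ 2 - (w z + a / 2 * ‖z - q.2‖ ^ 2) ≤ 0}) := by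
    have hK : IsCompact (closedBall (0 : En n) 1 ×ˢ closedBall (0 : En n) 1) :=
      (isCompact_closedBall _ _).prod (isCompact_closedBall _ _)
    refine hK.of_isClosed_subset ?_ (fun q hq => hq.1)
    have e : {q : En n × En n | q ∈ closedBall (0 : En n) 1 ×ˢ closedBall (0 : En n) 1 ∧
      ∀ z ∈ closedBall (0 : En n) 1, w q.1 + a / 2 * ‖q.1 - q.2‖ ^ 2 - (w z + a / 2 * ‖z - q.2‖ ^ 2) ≤ 0}
      = (closedBall (0 : En n) 1 ×ˢ closedBall (0 : En n) 1) ∩ ⋂ z : closedBall (0 : En n) 1,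
        ((closedBall (0 : En n) 1 ×ˢ closedBall (0 : En n) 1) ∩
        (fun q : En n × En n => w q.1 + a / 2 * ‖q.1 - q.2‖ ^ 2 - (w z + a / 2 * ‖(z : En n) - q.2‖ ^ 2)) ⁻¹' Iic 0) := by
      ext q
      simp only [mem_ofPred_eq, mem_inter_iff, mem_iInter, mem_preimage, mem_Iic, Subtype.forall]
      constructor
      · rintro ⟨h1, h2⟩; exact ⟨h1, fun z hz => ⟨h1, h2 z hz⟩⟩
      · rintro ⟨h1, h2⟩; exact ⟨h1, fun z hz => (h2 z hz).2⟩
    rw [e]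
    refine hK.isClosed.inter (isClosed_iInter fun z => ?_)
    refine ContinuousOn.preimage_isClosed_of_isClosed ?_ hK.isClosed isClosed_Iic
    have : ContinuousOn (fun q : En n × En n => w q.1) (closedBall (0 : En n) 1 ×ˢ closedBall (0 : En n) 1) :=
      hw.comp continuousOn_fst (fun q hq => hq.1)
    refine (this.add ?_).sub ?_
    · exact Continuous.continuousOn (by fun_prop)
    · exact Continuous.continuousOn (by fun_prop)
  have := (hC.image continuous_fst).isClosed
  convert this using 1
  ext x
  simp only [Ct, mem_ofPred_eq, mem_image, Prod.exists, exists_and_right, exists_eq_right, mem_prod]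
  constructor
  · rintro ⟨hx, y, hy, h⟩
    exact ⟨y, ⟨hx, hy⟩, fun z hz => by linarith [h z hz]⟩
  · rintro ⟨y, ⟨hx, hy⟩, h⟩
    exact ⟨hx, y, hy, fun z hz => by linarith [h z hz]⟩

set_option maxHeartbeats 1000000 in
theorem lemB {n : ℕ} {K : ℝ} (hK : 1 ≤ K) {Ω : Set (En n)} {w : En n → ℝ} (h : SupS K Ω w)
    (hc : ContinuousOn w Ω) (hΩ : closedBall 0 1 ⊆ Ω) (x₀ x₁ : En n) (a r : ℝ) (ha : 0 < a)
    (hr : 0 < r) (hsub : closedBall x₁ (2 * r) ⊆ closedBall 0 1) (hx : ‖x₀ - x₁‖ ≤ r)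
    (h0 : x₀ ∈ Ct w a) :
    volume (closedBall x₁ (2 * r)) ≤ ENNReal.ofReal ((256 * (9 * K)) ^ n) *
      volume (Ct w (a + 2048 * Real.exp (8192 * K) * a) ∩ closedBall x₁ (r / 8)) := by
  obtain ⟨hx₀, y, hy, hmin⟩ := h0
  obtain ⟨x₂, hx₂, hg⟩ := barrier hK h hc x₀ x₁ y a r ha hr (hsub.trans hΩ) hx
    (fun z hz => hmin z (hsub hz))
  set κ := Real.exp (8192 * K) with hκ
  have hκpos : 1 ≤ κ := by rw [hκ]; exact Real.one_le_exp (by positivity)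
  set b := 2048 * κ * a with hb
  have hbpos : 0 < b := by positivity
  have hab : a ≤ b := by rw [hb]; nlinarith
  set c : En n := (1 / (a + b)) • (a • y + b • x₂) with hcdef
  rw [mem_closedBall, dist_eq_norm] at hx₂
  have hex : ∀ v ∈ closedBall c (r / 128), ∃ x, ‖x - x₁‖ ≤ r / 8 ∧ x ∈ closedBall (0 : En n) 1 ∧
      v ∈ closedBall (0 : En n) 1 ∧ ∀ z ∈ closedBall (0 : En n) 1,
      w x + (a + b) / 2 * ‖x - v‖ ^ 2 ≤ w z + (a + b) / 2 * ‖z - v‖ ^ 2 := by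
    intro v hv
    rw [mem_closedBall, dist_eq_norm] at hv
    set y' := x₂ + ((a + b) / b) • (v - c) with hy'
    have hy'n : ‖y' - x₂‖ ≤ r / 64 := by
      rw [hy', add_sub_cancel_left, norm_smul, Real.norm_eq_abs, abs_of_pos (by positivity)]
      have : (a + b) / b ≤ 2 := by rw [div_le_iff₀ hbpos]; linarith
      calc (a + b) / b * ‖v - c‖ ≤ 2 * (r / 128) := by gcongr
        _ = r / 64 := by ring
    have hvy : v = (1 / (a + b)) • (a • y + b • y') := by
      have e : a • y + b • y' = (a • y + b • x₂) + (a + b) • (v - c) := by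
        rw [hy', smul_add, smul_smul, mul_div_cancel₀ _ hbpos.ne']; abel
      rw [e, smul_add, ← hcdef, smul_smul, one_div_mul_cancel (by positivity), one_smul]; abel
    have hy'D : y' ∈ closedBall (0 : En n) 1 := by
      apply hsub
      rw [mem_closedBall, dist_eq_norm]
      have := norm_add_le (y' - x₂) (x₂ - x₁)
      rw [sub_add_sub_cancel] at this
      linarith
    have hx₂D : x₂ ∈ closedBall (0 : En n) 1 := by
      apply hsub; rw [mem_closedBall, dist_eq_norm]; linarith
    have hvD : v ∈ closedBall (0 : En n) 1 := by
      rw [hvy]; exact conv_mem a b ha hbpos hy hy'D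
    have hcw : ContinuousOn (fun z => w z + (a + b) / 2 * ‖z - v‖ ^ 2) (closedBall 0 1) := by
      have := hc.mono hΩ
      fun_prop
    obtain ⟨x, hxD, hxm⟩ := (isCompact_closedBall (0 : En n) 1).exists_isMinOn ⟨x₂, hx₂D⟩ hcw
    refine ⟨x, ?_, hxD, hvD, fun z hz => hxm hz⟩
    have m1 : w x + (a + b) / 2 * ‖x - v‖ ^ 2 ≤ w x₂ + (a + b) / 2 * ‖x₂ - v‖ ^ 2 := hxm hx₂D
    have c1 := combine a b ha hbpos y y' x
    have c2 := combine a b ha hbpos y y' x₂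
    rw [← hvy] at c1 c2
    have m2 := hmin x hxD
    have m3 : b / 2 * ‖x - y'‖ ^ 2 ≤ κ * a * r ^ 2 + b / 2 * ‖x₂ - y'‖ ^ 2 := by linarith
    have m4 : ‖x₂ - y'‖ ^ 2 ≤ (r / 64) ^ 2 := by
      rw [norm_sub_rev]; exact pow_le_pow_left₀ (norm_nonneg _) hy'n 2
    have m5 := mul_le_mul_of_nonneg_left m4 (show 0 ≤ b / 2 by positivity)
    have m6 : (κ * a) * ‖x - y'‖ ^ 2 ≤ (κ * a) * (3 * r / 64) ^ 2 := by
      have e1 : b / 2 * ‖x - y'‖ ^ 2 = 1024 * ((κ * a) * ‖x - y'‖ ^ 2) := by rw [hb]; ring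
      have e2 : b / 2 * (r / 64) ^ 2 = (κ * a * r ^ 2) / 4 := by rw [hb]; ring
      have e3 : 0 ≤ κ * a * r ^ 2 := by positivity
      rw [e1] at m3
      rw [e2] at m5
      have e4 : (κ * a) * (3 * r / 64) ^ 2 = 9 / 4096 * (κ * a * r ^ 2) := by ring
      rw [e4]; linarith
    have m7 : ‖x - y'‖ ≤ 3 * r / 64 := by
      have := le_of_mul_le_mul_left m6 (by positivity)
      exact (pow_le_pow_iff_left₀ (norm_nonneg _) (by positivity) (by norm_num)).1 this
    have m8 : x - x₁ = (x - y') + (y' - x₂) + (x₂ - x₁) := by abel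
    rw [m8]
    have := norm_add₃_le (a := x - y') (b := y' - x₂) (c := x₂ - x₁)
    linarith
  choose! X hX1 hX2 hX3 hX4 using hex
  have hlip : ∀ v ∈ closedBall c (r / 128), ∀ v' ∈ closedBall c (r / 128),
      ‖v - v'‖ ≤ 9 * K * ‖X v - X v'‖ := by
    intro v hv v' hv'
    have key : ∀ ε > 0, ‖X v - X v'‖ ≤ ε → ‖v - v'‖ ≤ 9 * K * ε := by
      intro ε hε hle
      by_cases hcase : 5 * K * ε ≤ r
      · have hsb : closedBall (X v) (5 * K * ε) ⊆ closedBall (0 : En n) 1 := by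
          refine Subset.trans ?_ hsub
          apply closedBall_subset_closedBall'
          rw [dist_eq_norm]
          have := hX1 v hv
          linarith
        exact vertex_lip hK h (X v) (X v') v v' (a + b) ε (by positivity) hε hle
          (hsb.trans hΩ) hc (fun z hz => hX4 v hv z (hsb hz)) (fun z hz => hX4 v' hv' z (hsb hz))
      · push Not at hcase
        rw [mem_closedBall, dist_eq_norm] at hv hv'
        have : ‖v - v'‖ ≤ ‖v - c‖ + ‖v' - c‖ := by
          rw [← sub_sub_sub_cancel_right v v' c]; exact norm_sub_le _ _
        linarith
    rcases (norm_nonneg (X v - X v')).lt_or_eq with h1 | h1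
    · exact key _ h1 le_rfl
    · rw [← h1, mul_zero]
      refine le_of_forall_pos_le_add fun ε hε => ?_
      have := key (ε / (9 * K)) (by positivity) (by rw [← h1]; positivity)
      rw [mul_div_cancel₀ _ (by positivity)] at this
      linarith
  set V := closedBall c (r / 128) with hV
  have hinj : InjOn X V := by
    intro v hv v' hv' he
    have := hlip v hv v' hv'
    rw [he, sub_self, norm_zero, mul_zero] at this
    exact sub_eq_zero.1 (norm_le_zero_iff.1 this)
  have hl : LipschitzOnWith (Real.toNNReal (9 * K)) (Function.invFunOn X V) (X '' V) := by
    rw [lipschitzOnWith_iff_dist_le_mul]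
    rintro _ ⟨v, hv, rfl⟩ _ ⟨v', hv', rfl⟩
    rw [hinj.leftInvOn_invFunOn hv, hinj.leftInvOn_invFunOn hv', dist_eq_norm, dist_eq_norm,
      Real.coe_toNNReal _ (by positivity)]
    exact hlip v hv v' hv'
  have hvol := lip_measure _ _ _ hl
  have himg : Function.invFunOn X V '' (X '' V) = V := hinj.leftInvOn_invFunOn.image_image
  rw [himg] at hvol
  have hsubset : X '' V ⊆ Ct w (a + b) ∩ closedBall x₁ (r / 8) := by
    rintro _ ⟨v, hv, rfl⟩
    exact ⟨⟨hX2 v hv, v, hX3 v hv, hX4 v hv⟩, by rw [mem_closedBall, dist_eq_norm]; exact hX1 v hv⟩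
  have hscale : volume (closedBall x₁ (2 * r)) = ENNReal.ofReal (256 ^ n) * volume V := by
    rw [hV, Measure.addHaar_closedBall _ _ (by positivity), Measure.addHaar_closedBall _ _ (by positivity),
      ← mul_assoc, ← ENNReal.ofReal_mul (by positivity)]
    congr 2
    rw [finrank_euclideanSpace, Fintype.card_fin, ← mul_pow]
    congr 1; ring
  rw [hscale, mul_pow, ENNReal.ofReal_mul (by positivity), mul_assoc]
  gcongr
  rw [ENNReal.ofReal_pow (by positivity)]
  exact hvol.trans (by gcongr; exact le_rfl)

/-- complement of contact set -/
def Uc {n : ℕ} (w : En n → ℝ) (a : ℝ) : Set (En n) := ball 0 (1 / 8) \ Ct w a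

theorem geo {n : ℕ} (w : En n → ℝ) (a : ℝ) (hc : ContinuousOn w (closedBall 0 1))
    (hne : (Ct w a ∩ closedBall 0 (1 / 8)).Nonempty) (x : En n) (hx : x ∈ Uc w a) :
    ∃ x₁ x₀ : En n, ∃ d : ℝ, 0 < d ∧ d ≤ 1 / 4 ∧ x₀ ∈ Ct w a ∧ ‖x₀ - x₁‖ ≤ 3 / 2 * d ∧
      x ∈ closedBall x₁ (d / 2) ∧ closedBall x₁ (2 * (3 / 2 * d)) ⊆ closedBall 0 1 ∧
      closedBall x₁ (3 / 2 * d / 8) ⊆ Uc w a := by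
  have hcl : IsClosed (Ct w a ∩ closedBall 0 (1 / 8)) := (Ct_closed w a hc).inter isClosed_closedBall
  obtain ⟨x₀, hx₀, hd⟩ := hcl.exists_infDist_eq_dist hne x
  obtain ⟨hx1, hx2⟩ := hx
  rw [mem_ball_zero_iff] at hx1
  have hx₀n : ‖x₀‖ ≤ 1 / 8 := by simpa using hx₀.2
  set d := dist x x₀ with hdd
  have hdpos : 0 < d := by
    rw [hdd, dist_pos]; rintro rfl; exact hx2 hx₀.1
  have hd4 : d ≤ 1 / 4 := by
    rw [hdd, dist_eq_norm]; have := norm_sub_le x x₀; linarith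
  have hmind : ∀ z, ‖z‖ ≤ 1 / 8 → dist x z < d → z ∉ Ct w a := by
    intro z hz hz2 hz3
    have := infDist_le_dist_of_mem (x := x) (show z ∈ Ct w a ∩ closedBall 0 (1 / 8) from ⟨hz3, by simpa using hz⟩)
    linarith
  obtain ⟨x₁, h1, h2⟩ : ∃ x₁ : En n, ‖x₁ - x‖ ≤ d / 2 ∧ (x₁ = 0 ∨ ‖x₁‖ ≤ ‖x‖ - d / 2) := by
    by_cases hcase : ‖x‖ ≤ d / 2
    · exact ⟨0, by simpa using hcase, Or.inl rfl⟩
    · push Not at hcase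
      have hxp : 0 < ‖x‖ := by linarith
      refine ⟨(1 - d / (2 * ‖x‖)) • x, ?_, Or.inr ?_⟩
      · have : (1 - d / (2 * ‖x‖)) • x - x = -((d / (2 * ‖x‖)) • x) := by
          rw [sub_smul, one_smul]; abel
        rw [this, norm_neg, norm_smul, Real.norm_eq_abs, abs_of_pos (by positivity)]
        apply le_of_eq; field_simp
      · have h0 : d / (2 * ‖x‖) ≤ 1 := by rw [div_le_one (by positivity)]; linarith
        rw [norm_smul, Real.norm_eq_abs, abs_of_nonneg (by linarith)]
        apply le_of_eq; field_simp
  have hx₁n : ‖x₁‖ ≤ 1 / 8 := by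
    rcases h2 with h2 | h2
    · rw [h2]; simp
    · linarith
  refine ⟨x₁, x₀, d, hdpos, hd4, hx₀.1, ?_, ?_, ?_, ?_⟩
  · have e : x₀ - x₁ = (x - x₁) - (x - x₀) := by abel
    have := norm_sub_le (x - x₁) (x - x₀)
    rw [e]
    rw [hdd, dist_eq_norm] at *
    rw [norm_sub_rev] at h1
    linarith
  · rw [mem_closedBall, dist_comm, dist_eq_norm]; exact h1
  · apply closedBall_subset_closedBall'
    rw [dist_zero_right]; linarith
  · intro z hz
    rw [mem_closedBall, dist_eq_norm] at hz
    have hzn : ‖z‖ < 1 / 8 := by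
      have : ‖z‖ ≤ ‖z - x₁‖ + ‖x₁‖ := by simpa using norm_add_le (z - x₁) x₁
      rcases h2 with h2 | h2
      · rw [h2, norm_zero] at this; rw [h2] at hz; linarith
      · linarith
    refine ⟨by simpa using hzn, hmind z hzn.le ?_⟩
    rw [dist_comm]
    have := dist_triangle z x₁ x
    rw [dist_eq_norm z x₁, dist_eq_norm x₁ x] at this
    linarith

set_option maxHeartbeats 1000000 in
theorem lemC {n : ℕ} {K : ℝ} (hK : 1 ≤ K) {Ω : Set (En n)} {w : En n → ℝ} (h : SupS K Ω w)
    (hc : ContinuousOn w Ω) (hΩ : closedBall 0 1 ⊆ Ω) (a : ℝ) (ha : 0 < a)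
    (hne : (Ct w a ∩ closedBall 0 (1 / 8)).Nonempty) :
    volume (Uc w a) ≤ ENNReal.ofReal ((256 * (9 * K)) ^ n) *
      volume (Ct w (a + 2048 * Real.exp (8192 * K) * a) ∩ Uc w a) := by
  have hcD := hc.mono hΩ
  choose! x₁ x₀ d hd hd4 hx₀ hx₀₁ hxm hsub hgain using geo w a hcD hne
  obtain ⟨u, hut, hdis, hcov⟩ := Vitali.exists_disjoint_subfamily_covering_enlargement_closedBall
    (Uc w a) x₁ (fun x => d x / 2) (1 / 8) (fun x hx => by have := hd4 x hx; linarith) 5 (by norm_num)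
  set a' := a + 2048 * Real.exp (8192 * K) * a with ha'
  have hucount : u.Countable := by
    refine hdis.countable_of_nonempty_interior ?_
    intro x hx
    refine ⟨x₁ x, ?_⟩
    apply ball_subset_interior_closedBall
    apply mem_ball_self
    have := hd x (hut hx)
    positivity
  have hcover : Uc w a ⊆ ⋃ b ∈ u, closedBall (x₁ b) (2 * (3 / 2 * d b)) := by
    intro x hx
    obtain ⟨b, hb, hb2⟩ := hcov x hx
    refine mem_biUnion hb (closedBall_subset_closedBall ?_ (hb2 (hxm x hx)))
    have := hd b (hut hb)
    linarith
  set s : En n → Set (En n) := fun b => Ct w a' ∩ closedBall (x₁ b) (3 / 2 * d b / 8) with hs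
  have hsmeas : ∀ b ∈ u, MeasurableSet (s b) := fun b _ =>
    ((Ct_closed w a' hcD).inter isClosed_closedBall).measurableSet
  have hsdis : u.PairwiseDisjoint s := by
    refine hdis.mono_on fun b hb => ?_
    refine inter_subset_right.trans (closedBall_subset_closedBall ?_)
    have := hd b (hut hb)
    linarith
  calc volume (Uc w a) ≤ volume (⋃ b ∈ u, closedBall (x₁ b) (2 * (3 / 2 * d b))) := measure_mono hcover
    _ ≤ ∑' b : u, volume (closedBall (x₁ b) (2 * (3 / 2 * d b))) := measure_biUnion_le _ hucount _
    _ ≤ ∑' b : u, ENNReal.ofReal ((256 * (9 * K)) ^ n) * volume (s b) := by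
        refine ENNReal.tsum_le_tsum fun b => ?_
        have hb := hut b.2
        exact lemB hK h hc hΩ (x₀ b) (x₁ b) a _ ha (by have := hd b hb; positivity) (hsub b hb)
          (hx₀₁ b hb) (hx₀ b hb)
    _ = ENNReal.ofReal ((256 * (9 * K)) ^ n) * volume (⋃ b ∈ u, s b) := by
        rw [ENNReal.tsum_mul_left, measure_biUnion hucount hsdis hsmeas]
    _ ≤ _ := by
        gcongr
        apply iUnion₂_subset
        intro b hb
        exact inter_subset_inter_right _ (hgain b (hut hb))

theorem lemC' {n : ℕ} {K : ℝ} (hK : 1 ≤ K) {Ω : Set (En n)} {w : En n → ℝ} (h : SupS K Ω w)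
    (hc : ContinuousOn w Ω) (hΩ : closedBall 0 1 ⊆ Ω) (a : ℝ) (ha : 0 < a)
    (hne : (Ct w a ∩ closedBall 0 (1 / 8)).Nonempty) :
    volume.real (Uc w (a + 2048 * Real.exp (8192 * K) * a)) ≤
      (1 - 1 / (256 * (9 * K)) ^ n) * volume.real (Uc w a) := by
  have h1 := lemC hK h hc hΩ a ha hne
  set a' := a + 2048 * Real.exp (8192 * K) * a with ha'
  have hm : MeasurableSet (Ct w a') := (Ct_closed w a' (hc.mono hΩ)).measurableSet
  have hfin : volume (Uc w a) ≠ ⊤ := by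
    refine (lt_of_le_of_lt (measure_mono sdiff_subset) ?_).ne
    exact measure_ball_lt_top
  have hfin2 : volume (Ct w a' ∩ Uc w a) ≠ ⊤ := (lt_of_le_of_lt (measure_mono inter_subset_right) hfin.lt_top).ne
  have e : Uc w a' = Uc w a \ Ct w a' := by
    have : Ct w a ⊆ Ct w a' := Ct_mono w a _ ha (by positivity)
    ext x
    simp only [Uc, mem_sdiff]
    constructor
    · rintro ⟨h1, h2⟩; exact ⟨⟨h1, fun h => h2 (this h)⟩, h2⟩
    · rintro ⟨⟨h1, _⟩, h2⟩; exact ⟨h1, h2⟩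
  have h2 : volume.real (Uc w a ∩ Ct w a') + volume.real (Uc w a \ Ct w a') = volume.real (Uc w a) :=
    measureReal_inter_add_sdiff hm hfin
  have hCpos : 0 < (256 * (9 * K)) ^ n := by positivity
  have h3 : volume.real (Uc w a) ≤ (256 * (9 * K)) ^ n * volume.real (Ct w a' ∩ Uc w a) := by
    have := ENNReal.toReal_mono (ENNReal.mul_ne_top ENNReal.ofReal_ne_top hfin2) h1
    rwa [ENNReal.toReal_mul, ENNReal.toReal_ofReal hCpos.le] at this
  rw [← e, inter_comm] at h2
  have h4 : volume.real (Uc w a) / (256 * (9 * K)) ^ n ≤ volume.real (Ct w a' ∩ Uc w a) := by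
    rw [div_le_iff₀ hCpos]; linarith
  have h5 : (1 - 1 / (256 * (9 * K)) ^ n) * volume.real (Uc w a) =
    volume.real (Uc w a) - volume.real (Uc w a) / (256 * (9 * K)) ^ n := by ring
  rw [h5]; linarith

theorem lemD (n : ℕ) {K : ℝ} (hK : 1 ≤ K) : ∃ H : ℝ, 1 ≤ H ∧ ∀ (Ω : Set (En n)) (w : En n → ℝ),
    SupS K Ω w → ContinuousOn w Ω → closedBall 0 1 ⊆ Ω → (∀ x ∈ closedBall (0 : En n) 1, 0 ≤ w x) →
    (∃ x ∈ closedBall (0 : En n) (1 / 16), w x ≤ 1) →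
    volume.real (ball (0 : En n) (1 / 8) ∩ {x | H < w x}) < 1 / 2 * volume.real (ball (0 : En n) (1 / 8)) := by
  set θ : ℝ := 1 - 1 / (256 * (9 * K)) ^ n with hθ
  set N : ℝ := 1 + 2048 * Real.exp (8192 * K) with hN
  have hCb : (1 : ℝ) ≤ (256 * (9 * K)) ^ n := one_le_pow₀ (by linarith)
  have hθ0 : 0 ≤ θ := by
    rw [hθ, sub_nonneg]; exact (div_le_one (by positivity)).2 hCb
  have hθ1 : θ < 1 := by
    have : 0 < 1 / (256 * (9 * K)) ^ n := by positivity
    linarith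
  obtain ⟨k, hk⟩ := exists_pow_lt_of_lt_one (show (0 : ℝ) < 1 / 2 by norm_num) hθ1
  have hNpos : 0 < N := by positivity
  refine ⟨1 + 2 * (N ^ k * 512), by have : 0 < N ^ k := by positivity
                                    linarith, ?_⟩
  intro Ω w h hc hΩ hpos ⟨xs, hxs, hwxs⟩
  have hcD := hc.mono hΩ
  rw [mem_closedBall_zero_iff] at hxs
  have hxsD : xs ∈ closedBall (0 : En n) 1 := by rw [mem_closedBall_zero_iff]; linarith
  have base : (Ct w 512 ∩ closedBall 0 (1 / 8)).Nonempty := by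
    have hcw : ContinuousOn (fun z => w z + 512 / 2 * ‖z - 0‖ ^ 2) (closedBall 0 1) := by
      fun_prop
    obtain ⟨x, hxD, hxm⟩ := (isCompact_closedBall (0 : En n) 1).exists_isMinOn ⟨xs, hxsD⟩ hcw
    refine ⟨x, ⟨hxD, 0, by simp, fun z hz => hxm hz⟩, ?_⟩
    have h1 : w x + 512 / 2 * ‖x - 0‖ ^ 2 ≤ w xs + 512 / 2 * ‖xs - 0‖ ^ 2 := hxm hxsD
    rw [sub_zero, sub_zero] at h1
    have h2 := hpos x hxD
    have h3 := pow_le_pow_left₀ (norm_nonneg _) hxs 2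
    rw [mem_closedBall_zero_iff]
    by_contra hh
    push Not at hh
    have h4 := pow_lt_pow_left₀ hh (by norm_num) (two_ne_zero)
    linarith
  have iter : ∀ j : ℕ, (Ct w (N ^ j * 512) ∩ closedBall 0 (1 / 8)).Nonempty ∧
      volume.real (Uc w (N ^ j * 512)) ≤ θ ^ j * volume.real (ball (0 : En n) (1 / 8)) := by
    intro j
    induction j with
    | zero =>
      simp only [pow_zero, one_mul]
      exact ⟨base, measureReal_mono sdiff_subset measure_ball_lt_top.ne⟩
    | succ j ih =>
      have hp : 0 < N ^ j * 512 := by positivity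
      have e : N ^ (j + 1) * 512 = N ^ j * 512 + 2048 * Real.exp (8192 * K) * (N ^ j * 512) := by
        rw [pow_succ, hN]; ring
      rw [e]
      refine ⟨ih.1.mono (inter_subset_inter_left _ (Ct_mono w _ _ hp (by positivity))), ?_⟩
      refine (lemC' hK h hc hΩ _ hp ih.1).trans ?_
      rw [pow_succ', mul_assoc]
      exact mul_le_mul_of_nonneg_left ih.2 hθ0
  have hsub : ball (0 : En n) (1 / 8) ∩ {x | 1 + 2 * (N ^ k * 512) < w x} ⊆ Uc w (N ^ k * 512) := by
    rintro x ⟨hx1, hx2⟩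
    refine ⟨hx1, ?_⟩
    rintro ⟨hxD, y, hy, hmin⟩
    have h1 := hmin xs hxsD
    have hN0 : 0 ≤ N ^ k * 512 / 2 := by positivity
    have h2 : ‖xs - y‖ ^ 2 ≤ 2 ^ 2 := by
      refine pow_le_pow_left₀ (norm_nonneg _) ?_ 2
      rw [mem_closedBall_zero_iff] at hy
      have := norm_sub_le xs y
      linarith
    have h3 := mul_le_mul_of_nonneg_left h2 hN0
    have h4 : 0 ≤ N ^ k * 512 / 2 * ‖x - y‖ ^ 2 := by positivity
    rw [mem_ofPred_eq] at hx2
    linarith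
  have hballpos : 0 < volume.real (ball (0 : En n) (1 / 8)) :=
    ENNReal.toReal_pos (measure_ball_pos _ _ (by norm_num)).ne' measure_ball_lt_top.ne
  calc _ ≤ volume.real (Uc w (N ^ k * 512)) := measureReal_mono hsub
          (lt_of_le_of_lt (measure_mono sdiff_subset) measure_ball_lt_top).ne
    _ ≤ _ := (iter k).2
    _ < _ := mul_lt_mul_of_pos_right hk hballpos

theorem osc (n : ℕ) {K : ℝ} (hK : 1 ≤ K) : ∃ σ : ℝ, 0 < σ ∧ σ ≤ 1 / 3 ∧ ∀ (Ω : Set (En n)) (w : En n → ℝ),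
    SupS K Ω w → SupS K Ω (fun x => - w x) → ContinuousOn w Ω → closedBall 0 1 ⊆ Ω → ∀ m O : ℝ, 0 < O →
    (∀ x ∈ closedBall (0 : En n) 1, m ≤ w x ∧ w x ≤ m + O) →
    (∀ x ∈ closedBall (0 : En n) (1 / 16), m + σ * O ≤ w x) ∨
    (∀ x ∈ closedBall (0 : En n) (1 / 16), w x ≤ m + O - σ * O) := by
  obtain ⟨H, hH, hD⟩ := lemD n hK
  refine ⟨1 / (3 * H), by positivity, ?_, ?_⟩
  · rw [div_le_div_iff₀ (by positivity) (by norm_num)]; linarith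
  intro Ω w h1 h2 hc hΩ m O hO hb
  by_contra hcon
  push Not at hcon
  obtain ⟨⟨p, hp, hp2⟩, ⟨q, hq, hq2⟩⟩ := hcon
  have hk : 0 < 3 * H / O := by positivity
  have eσ : 3 * H / O * (1 / (3 * H) * O) = 1 := by field_simp
  have eO : 3 * H / O * O = 3 * H := by field_simp
  have a1 := h1.affine 0 1 (3 * H / O) (-(3 * H / O * m)) one_pos hk
  have a2 := h2.affine 0 1 (3 * H / O) (3 * H / O * (m + O)) one_pos hk
  simp only [one_smul, zero_add, ofPred_mem_eq] at a1 a2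
  have b1 := hD Ω _ a1 (by fun_prop) hΩ (fun x hx => by
    have := mul_le_mul_of_nonneg_left (hb x hx).1 hk.le; linarith) ⟨p, hp, by
    have := mul_le_mul_of_nonneg_left hp2.le hk.le; linarith⟩
  have b2 := hD Ω _ a2 (by fun_prop) hΩ (fun x hx => by
    have := mul_le_mul_of_nonneg_left (hb x hx).2 hk.le; linarith) ⟨q, hq, by
    have := mul_le_mul_of_nonneg_left hq2.le hk.le; linarith⟩
  have hsub : ball (0 : En n) (1 / 8) ⊆
      (ball (0 : En n) (1 / 8) ∩ {x | H < 3 * H / O * w x + -(3 * H / O * m)}) ∪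
      (ball (0 : En n) (1 / 8) ∩ {x | H < 3 * H / O * -w x + 3 * H / O * (m + O)}) := by
    intro x hx
    by_cases hcase : H < 3 * H / O * w x + -(3 * H / O * m)
    · exact Or.inl ⟨hx, hcase⟩
    · refine Or.inr ⟨hx, ?_⟩
      rw [mem_ofPred_eq]
      linarith
  have h3 : volume.real (ball (0 : En n) (1 / 8)) ≤ _ :=
    (measureReal_mono hsub (by
      refine (lt_of_le_of_lt (measure_mono (union_subset inter_subset_left inter_subset_left)) measure_ball_lt_top).ne)).trans (measureReal_union_le _ _)
  linarith

set_option maxHeartbeats 1000000 in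
theorem holder (n : ℕ) {K : ℝ} (hK : 1 ≤ K) : ∃ α : ℝ, 0 < α ∧ α < 1 ∧
    ∀ (x₀ : En n) (R N : ℝ) (w : En n → ℝ), 0 < R → 0 < N →
    SupS K (ball x₀ R) w → SupS K (ball x₀ R) (fun x => - w x) → ContinuousOn w (ball x₀ R) →
    (∀ x ∈ ball x₀ R, |w x| ≤ N) → ∀ z ∈ ball x₀ R, |w z - w x₀| ≤ 6 * N * (‖z - x₀‖ / R) ^ α := by
  obtain ⟨σ, hσ, hσ3, hosc⟩ := osc n hK
  set θ := 1 - σ with hθ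
  have hθ0 : 0 < θ := by linarith
  have hθ1 : θ < 1 := by linarith
  have hl16 : Real.log (1 / 16) < 0 := Real.log_neg (by norm_num) (by norm_num)
  set α := Real.log θ / Real.log (1 / 16) with hα
  have hα0 : 0 < α := div_pos_of_neg_of_neg (Real.log_neg hθ0 hθ1) hl16
  have hα1 : α < 1 := by
    rw [hα, div_lt_one_of_neg hl16]
    exact Real.log_lt_log (by norm_num) (by linarith)
  have hpow : (1 / 16 : ℝ) ^ α = θ := by
    rw [Real.rpow_def_of_pos (by norm_num), hα, mul_div_cancel₀ _ hl16.ne, Real.exp_log hθ0]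
  refine ⟨α, hα0, hα1, ?_⟩
  intro x₀ R N w hR hN h1 h2 hc hb z hz
  have iter : ∀ k : ℕ, ∃ m : ℝ, ∀ x ∈ closedBall x₀ (R / 2 * (1 / 16) ^ k),
      m ≤ w x ∧ w x ≤ m + 2 * N * θ ^ k := by
    intro k
    induction k with
    | zero =>
      refine ⟨-N, fun x hx => ?_⟩
      have : x ∈ ball x₀ R := closedBall_subset_ball (by linarith) hx
      have := abs_le.1 (hb x this)
      simp only [pow_zero, mul_one]
      constructor <;> linarith
    | succ k ih =>
      obtain ⟨m, hm⟩ := ih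
      set r := R / 2 * (1 / 16) ^ k with hr
      have hrpos : 0 < r := by positivity
      have hrR : r < R := by
        have : (1 / 16 : ℝ) ^ k ≤ 1 := pow_le_one₀ (by norm_num) (by norm_num)
        have := mul_le_mul_of_nonneg_left this (show 0 ≤ R / 2 by positivity)
        rw [hr]; linarith
      have a1 := h1.affine x₀ r 1 0 hrpos one_pos
      have a2 := h2.affine x₀ r 1 0 hrpos one_pos
      simp only [one_mul, add_zero] at a1 a2
      have hmem : ∀ x : En n, ∀ s : ℝ, x ∈ closedBall (0 : En n) s → x₀ + r • x ∈ closedBall x₀ (r * s) := by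
        intro x s hx
        rw [mem_closedBall_zero_iff] at hx
        rw [mem_closedBall, dist_eq_norm, add_sub_cancel_left, norm_smul, Real.norm_eq_abs, abs_of_pos hrpos]
        gcongr
      have hsub : closedBall (0 : En n) 1 ⊆ {x | x₀ + r • x ∈ ball x₀ R} := by
        intro x hx
        have := hmem x 1 hx
        rw [mul_one] at this
        rw [mem_ofPred_eq]
        exact closedBall_subset_ball hrR this
      have hcc : ContinuousOn (fun x => w (x₀ + r • x)) {x | x₀ + r • x ∈ ball x₀ R} :=
        hc.comp (Continuous.continuousOn (by fun_prop)) (fun x hx => hx)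
      have hO := hosc _ _ a1 a2 hcc hsub m (2 * N * θ ^ k) (by positivity) (fun x hx => by
        have := hmem x 1 hx
        rw [mul_one] at this
        exact hm _ this)
      have eθ : 2 * N * θ ^ (k + 1) = 2 * N * θ ^ k - σ * (2 * N * θ ^ k) := by
        rw [pow_succ, hθ]; ring
      have back : ∀ x ∈ closedBall x₀ (R / 2 * (1 / 16) ^ (k + 1)), ∃ x' ∈ closedBall (0 : En n) (1 / 16),
          x₀ + r • x' = x := by
        intro x hx
        refine ⟨(1 / r) • (x - x₀), ?_, ?_⟩
        · rw [mem_closedBall, dist_eq_norm] at hx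
          rw [mem_closedBall_zero_iff, norm_smul, Real.norm_eq_abs, abs_of_pos (by positivity),
            div_mul_eq_mul_div, one_mul, div_le_iff₀ hrpos]
          refine hx.trans (le_of_eq ?_)
          rw [hr, pow_succ]; ring
        · rw [smul_smul, mul_one_div_cancel hrpos.ne', one_smul]; abel
      have hsm : ∀ x ∈ closedBall x₀ (R / 2 * (1 / 16) ^ (k + 1)), m ≤ w x ∧ w x ≤ m + 2 * N * θ ^ k := by
        intro x hx
        refine hm x (closedBall_subset_closedBall ?_ hx)
        rw [hr, pow_succ]
        have : 0 ≤ R / 2 * (1 / 16) ^ k := by positivity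
        linarith
      rcases hO with hO | hO
      · refine ⟨m + σ * (2 * N * θ ^ k), fun x hx => ?_⟩
        obtain ⟨x', hx', rfl⟩ := back x hx
        have h3 := hO x' hx'
        have h4 := hsm _ hx
        rw [eθ]
        constructor <;> linarith
      · refine ⟨m, fun x hx => ?_⟩
        obtain ⟨x', hx', rfl⟩ := back x hx
        have h3 := hO x' hx'
        have h4 := hsm _ hx
        rw [eθ]
        constructor <;> linarith
  have hx₀ : x₀ ∈ ball x₀ R := mem_ball_self hR
  rcases (norm_nonneg (z - x₀)).eq_or_lt with h0 | h0
  · have : z = x₀ := sub_eq_zero.1 (norm_eq_zero.1 h0.symm)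
    rw [this]; simp only [sub_self, abs_zero]; positivity
  set t := ‖z - x₀‖ / R with ht
  have htpos : 0 < t := by positivity
  have hzt : ‖z - x₀‖ = R * t := by rw [ht]; field_simp
  have h2α : (2 * t) ^ α ≤ 2 * t ^ α := by
    rw [Real.mul_rpow (by norm_num) htpos.le]
    gcongr
    calc (2 : ℝ) ^ α ≤ 2 ^ (1 : ℝ) := Real.rpow_le_rpow_of_exponent_le (by norm_num) hα1.le
      _ = 2 := by norm_num
  by_cases hcase : 2 * t ≤ 1
  · obtain ⟨k, hk1, hk2⟩ := exists_nat_pow_near_of_lt_one (show 0 < 2 * t by positivity) hcase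
      (show (0 : ℝ) < 1 / 16 by norm_num) (by norm_num)
    obtain ⟨m, hm⟩ := iter k
    have e1 := hm z (by
      rw [mem_closedBall, dist_eq_norm, hzt]
      have := mul_le_mul_of_nonneg_left hk2 (show 0 ≤ R / 2 by positivity)
      linarith)
    have e2 := hm x₀ (mem_closedBall_self (by positivity))
    have e3 : |w z - w x₀| ≤ 2 * N * θ ^ k := by rw [abs_le]; constructor <;> linarith
    refine e3.trans ?_
    have e4 : θ ^ (k + 1) ≤ 2 * t ^ α := by
      refine le_trans (le_of_eq ?_) ((Real.rpow_le_rpow (by positivity) hk1.le hα0.le).trans h2α)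
      rw [← hpow, ← Real.rpow_natCast, ← Real.rpow_natCast, ← Real.rpow_mul (by norm_num),
        ← Real.rpow_mul (by norm_num), mul_comm]
    have e5 : θ ^ k ≤ 3 * t ^ α := by
      rw [pow_succ] at e4
      have : 2 / 3 ≤ θ := by linarith
      have := mul_le_mul_of_nonneg_left this (show 0 ≤ θ ^ k by positivity)
      linarith
    have := mul_le_mul_of_nonneg_left e5 (show 0 ≤ 2 * N by positivity)
    linarith
  · push Not at hcase
    have e1 := abs_le.1 (hb z hz)
    have e2 := abs_le.1 (hb x₀ hx₀)
    have e3 : |w z - w x₀| ≤ 2 * N * 1 := by rw [abs_le]; constructor <;> linarith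
    refine e3.trans ?_
    have e4 : 1 ≤ (2 * t) ^ α := Real.one_le_rpow hcase.le hα0.le
    have := mul_le_mul_of_nonneg_left (e4.trans h2α) (show 0 ≤ 2 * N by positivity)
    have : 0 ≤ N * t ^ α := by positivity
    linarith

theorem density {n : ℕ} (A : Set (En n)) : ∀ᵐ ξ : En n, ξ ∈ A → ∀ m : ℕ, 0 < m →
    ∀ᶠ r in 𝓝[>] (0 : ℝ), ∀ p ∈ closedBall ξ r, ∃ a ∈ A, dist a p ≤ r / m := by
  apply ae_imp_of_ae_restrict
  rw [ae_all_iff]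
  intro m
  filter_upwards [IsUnifLocDoublingMeasure.ae_tendsto_measure_inter_div (volume : Measure (En n)) A m] with ξ hξ hm
  have hmpos : (0 : ℝ) < m := by exact_mod_cast hm
  classical
  set bad : ℝ → En n → Prop := fun r p => p ∈ closedBall ξ r ∧ ∀ a ∈ A, ¬ dist a p ≤ r / m with hbad
  set P : ℝ → En n := fun r => if h : ∃ p, bad r p then h.choose else ξ with hP
  have hPm : ∀ r, 0 < r → P r ∈ closedBall ξ r := by
    intro r hr
    simp only [hP]
    split_ifs with h
    · exact h.choose_spec.1
    · exact mem_closedBall_self hr.le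
  have ht : Filter.Tendsto (fun r : ℝ => r / m) (𝓝[>] 0) (𝓝[>] 0) := by
    apply tendsto_nhdsWithin_of_tendsto_nhds_of_eventually_within
    · have : ContinuousAt (fun r : ℝ => r / m) 0 := by fun_prop
      rw [ContinuousAt, zero_div] at this
      exact this.mono_left nhdsWithin_le_nhds
    · filter_upwards [self_mem_nhdsWithin] with r hr
      have : (0 : ℝ) < r := hr
      show 0 < r / m
      positivity
  have h1 := hξ P (fun r => r / m) ht (by
    filter_upwards [self_mem_nhdsWithin] with r hr
    rw [mul_div_cancel₀ _ hmpos.ne', mem_closedBall, dist_comm]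
    exact hPm r hr)
  have h2 := h1.eventually (lt_mem_nhds (show (0 : ENNReal) < 1 by norm_num))
  filter_upwards [h2] with r hr p hp
  by_contra hcon
  push Not at hcon
  have hex : ∃ p, bad r p := ⟨p, hp, fun a ha => not_le.2 (hcon a ha)⟩
  have hb : bad r (P r) := by
    simp only [hP, hex, dif_pos]; exact hex.choose_spec
  have : A ∩ closedBall (P r) (r / m) = ∅ := by
    rw [eq_empty_iff_forall_notMem]
    rintro a ⟨ha, ha2⟩
    exact hb.2 a ha ha2
  rw [this] at hr
  simp at hr

theorem grad_lip {n : ℕ} (f : En n → ℝ) (A : Set (En n)) (G : En n → En n) (C ρ : ℝ)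
    (hf : ∀ a ∈ A, ∀ z, ‖z‖ ≤ ρ → |f (a + z) - f a - inner ℝ (G a) z| ≤ C * ‖z‖ ^ 2)
    (ξ ξ' : En n) (hξ : ξ ∈ A) (hξ' : ξ' ∈ A) (hC : 0 ≤ C) (hd : ‖ξ' - ξ‖ ≤ ρ / 2) :
    ‖G ξ' - G ξ‖ ≤ 6 * C * ‖ξ' - ξ‖ := by
  set h := ξ' - ξ with hh
  set g := G ξ' - G ξ with hg
  rcases (norm_nonneg g).eq_or_lt with h0 | h0
  · rw [← h0]; positivity
  set z : En n := (‖h‖ / ‖g‖) • g with hz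
  have hzn : ‖z‖ = ‖h‖ := by
    rw [hz, norm_smul, Real.norm_eq_abs, abs_of_nonneg (by positivity)]; field_simp
  have hzg : inner ℝ g z = ‖h‖ * ‖g‖ := by
    rw [hz, inner_smul_right, real_inner_self_eq_norm_sq]; field_simp
  have hzgG : inner ℝ (G ξ') z - inner ℝ (G ξ) z = ‖h‖ * ‖g‖ := by
    rw [← inner_sub_left, hzg]
  have hn := norm_nonneg h
  have hhz : ‖h + z‖ ≤ 2 * ‖h‖ := by have := norm_add_le h z; linarith
  have e1 := abs_le.1 (hf ξ hξ (h + z) (by linarith))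
  have e2 := abs_le.1 (hf ξ hξ h (by linarith))
  have e3 := abs_le.1 (hf ξ' hξ' z (by linarith))
  have p1 : ξ + (h + z) = ξ' + z := by rw [hh]; abel
  have p2 : ξ + h = ξ' := by rw [hh]; abel
  rw [p1, inner_add_right] at e1
  rw [p2] at e2
  rw [hzn] at e3
  have e4 : C * ‖h + z‖ ^ 2 ≤ C * (2 * ‖h‖) ^ 2 := by gcongr
  have e5 : ‖h‖ * ‖g‖ ≤ ‖h‖ * (6 * C * ‖h‖) := by nlinarith
  rcases hn.eq_or_lt with h1 | h1
  · have hz0 : h = 0 := norm_eq_zero.1 h1.symm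
    have : ξ' = ξ := sub_eq_zero.1 hz0
    rw [hg, this] at h0; simp at h0
  · exact le_of_mul_le_mul_left e5 h1

set_option maxHeartbeats 1000000 in
theorem second_order {n : ℕ} (f : En n → ℝ) (A : Set (En n)) (G : En n → En n) (C ρ : ℝ)
    (hf : ∀ a ∈ A, ∀ z, ‖z‖ ≤ ρ → |f (a + z) - f a - inner ℝ (G a) z| ≤ C * ‖z‖ ^ 2)
    (hC : 0 ≤ C) (hρ : 0 < ρ) (ξ : En n) (T : En n →L[ℝ] En n)
    (hT : HasFDerivWithinAt G T A ξ)
    (hden : ∀ m : ℕ, 0 < m → ∀ᶠ r in 𝓝[>] (0 : ℝ), ∀ p ∈ closedBall ξ r, ∃ a ∈ A, dist a p ≤ r / m)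
    (δ : ℝ) (hδ : 0 < δ) : ∀ᶠ z in 𝓝 (0 : En n),
      |f (ξ + z) - f ξ - inner ℝ (G ξ) z - 1 / 2 * inner ℝ (T z) z| ≤ δ * ‖z‖ ^ 2 := by
  set c : ℝ := 5 * C + 2 + 2 * ‖T‖ with hc
  have hcpos : 0 < c := by positivity
  obtain ⟨m, hm⟩ := exists_nat_gt (c / δ)
  have hmpos : (0 : ℝ) < m := lt_trans (by positivity) hm
  have hm0 : 0 < m := by exact_mod_cast hmpos
  have hm1 : (1 : ℝ) ≤ m := by exact_mod_cast hm0
  have hcm : c / m ≤ δ := by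
    rw [div_lt_iff₀ hδ] at hm
    rw [div_le_iff₀ hmpos]; linarith
  have h1 := hT.isLittleO.bound (show (0 : ℝ) < 1 / m by positivity)
  rw [eventually_nhdsWithin_iff, Metric.eventually_nhds_iff] at h1
  obtain ⟨r₁, hr₁, h1⟩ := h1
  have h2 := hden m hm0
  rw [eventually_nhdsWithin_iff, Metric.eventually_nhds_iff] at h2
  obtain ⟨r₂, hr₂, h2⟩ := h2
  rw [Metric.eventually_nhds_iff]
  refine ⟨min (r₁ / 2) (min r₂ (ρ / 2)), by positivity, fun z hz => ?_⟩
  rw [dist_zero_right, lt_min_iff, lt_min_iff] at hz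
  obtain ⟨hz1, hz2, hz3⟩ := hz
  rcases (norm_nonneg z).eq_or_lt with h0 | h0
  · have : z = 0 := norm_eq_zero.1 h0.symm
    rw [this]; simp
  set r := ‖z‖ with hr
  have h3 := h2 (y := r) (by rw [Real.dist_eq, sub_zero, abs_of_pos h0]; exact hz2) h0
  set h : En n := (1 / (m : ℝ)) • z with hh
  have hhn : ‖h‖ = r / m := by
    rw [hh, norm_smul, Real.norm_eq_abs, abs_of_pos (by positivity)]; ring
  have hrm : r / m ≤ r := div_le_self h0.le hm1
  set e : En n → ℝ := fun z => f (ξ + z) - f ξ - inner ℝ (G ξ) z - 1 / 2 * inner ℝ (T z) z with he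
  have step : ∀ j : ℕ, j < m → |e ((j + 1 : ℝ) • h) - e ((j : ℝ) • h)| ≤ c * (r / m) ^ 2 := by
    intro j hj
    have hjm : (j : ℝ) ≤ m := by exact_mod_cast hj.le
    set p : En n := (j : ℝ) • h with hp
    have hpn : ‖p‖ ≤ r := by
      rw [hp, norm_smul, Real.norm_eq_abs, abs_of_nonneg (by positivity), hhn]
      calc (j : ℝ) * (r / m) ≤ m * (r / m) := by gcongr
        _ = r := by field_simp
    obtain ⟨a, ha, had⟩ := h3 (ξ + p) (by rw [mem_closedBall, dist_eq_norm, add_sub_cancel_left]; exact hpn)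
    set q : En n := ξ + p - a with hq
    have hqn : ‖q‖ ≤ r / m := by rw [hq, ← dist_eq_norm, dist_comm]; exact had
    have haξ : a - ξ = p - q := by rw [hq]; abel
    have haξn : ‖a - ξ‖ ≤ 2 * r := by
      rw [haξ]; have := norm_sub_le p q; linarith
    have g1 := h1 (y := a) (by rw [dist_eq_norm]; linarith) ha
    have hqh : ‖q + h‖ ≤ 2 * (r / m) := by have := norm_add_le q h; linarith
    have E1 := abs_le.1 (hf a ha q (by linarith))
    have E2 := abs_le.1 (hf a ha (q + h) (by linarith))
    have pt1 : a + q = ξ + p := by rw [hq]; abel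
    have pt2 : a + (q + h) = ξ + (p + h) := by rw [hq]; abel
    rw [pt1] at E1
    rw [pt2, inner_add_right] at E2
    have C1 : C * ‖q‖ ^ 2 ≤ C * (r / m) ^ 2 := by gcongr
    have C2 : C * ‖q + h‖ ^ 2 ≤ C * (2 * (r / m)) ^ 2 := by gcongr
    set err := G a - G ξ - T (a - ξ) with herr
    have herrn : ‖err‖ ≤ 2 * (r / m) := by
      refine g1.trans ?_
      calc 1 / (m : ℝ) * ‖a - ξ‖ ≤ 1 / (m : ℝ) * (2 * r) := by gcongr
        _ = _ := by ring
    have hGa : inner ℝ (G a) h = inner ℝ (G ξ) h + inner ℝ (T p) h - inner ℝ (T q) h + inner ℝ err h := by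
      have : G a = G ξ + T p - T q + err := by
        have h5 : T (a - ξ) = T p - T q := by rw [haξ, map_sub]
        have h6 : G a = err + G ξ + T (a - ξ) := by rw [herr, sub_add_eq_add_sub, sub_add_cancel, sub_add_cancel]
        rw [h6, h5]; abel
      rw [this, inner_add_left, inner_sub_left, inner_add_left]
    have i1 : |inner ℝ err h| ≤ 2 * (r / m) ^ 2 := by
      refine (abs_real_inner_le_norm _ _).trans ?_
      rw [hhn]
      have := mul_le_mul_of_nonneg_right herrn (show 0 ≤ r / m by positivity)
      linarith
    have i2 : |inner ℝ (T q) h| ≤ ‖T‖ * (r / m) ^ 2 := by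
      refine (abs_real_inner_le_norm _ _).trans ?_
      rw [hhn]
      calc ‖T q‖ * (r / m) ≤ (‖T‖ * (r / m)) * (r / m) := by
            gcongr; exact (T.le_opNorm q).trans (by gcongr)
        _ = _ := by ring
    have i3 : |inner ℝ (T h) h| ≤ ‖T‖ * (r / m) ^ 2 := by
      refine (abs_real_inner_le_norm _ _).trans ?_
      rw [hhn]
      calc ‖T h‖ * (r / m) ≤ (‖T‖ * (r / m)) * (r / m) := by
            gcongr; exact (T.le_opNorm h).trans (by rw [hhn])
        _ = _ := by ring
    have k1 : inner ℝ (T p) h = j * inner ℝ (T h) h := by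
      rw [hp, map_smul, inner_smul_left]; simp
    have k2 : inner ℝ (T h) p = j * inner ℝ (T h) h := by
      rw [hp, inner_smul_right]
    have ed : e ((j + 1 : ℝ) • h) = f (ξ + (p + h)) - f ξ - inner ℝ (G ξ) p - inner ℝ (G ξ) h
        - 1 / 2 * (inner ℝ (T p) p + inner ℝ (T p) h + inner ℝ (T h) p + inner ℝ (T h) h) := by
      simp only [he]
      rw [add_smul, one_smul, ← hp, inner_add_right, map_add, inner_add_left, inner_add_right, inner_add_right]
      ring
    have ed2 : e p = f (ξ + p) - f ξ - inner ℝ (G ξ) p - 1 / 2 * inner ℝ (T p) p := rfl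
    rw [ed, ed2, k1, k2]
    rw [k1] at hGa
    have i1 := abs_le.1 i1
    have i2 := abs_le.1 i2
    have i3 := abs_le.1 i3
    have T0 : 0 ≤ ‖T‖ * (r / m) ^ 2 := by positivity
    have hcc : c * (r / m) ^ 2 = 5 * (C * (r / m) ^ 2) + 2 * (r / m) ^ 2 + 2 * (‖T‖ * (r / m) ^ 2) := by
      rw [hc]; ring
    rw [hcc, abs_le]
    constructor
    · linarith
    · linarith
  have ind : ∀ j : ℕ, j ≤ m → |e ((j : ℝ) • h)| ≤ j * (c * (r / m) ^ 2) := by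
    intro j
    induction j with
    | zero => intro _; simp [he]
    | succ j ih =>
      intro hj
      have a1 := abs_le.1 (ih (by omega))
      have a2 := abs_le.1 (step j (by omega))
      push_cast
      rw [abs_le]
      constructor <;> linarith
  have fin := ind m le_rfl
  have hmh : (m : ℝ) • h = z := by rw [hh, smul_smul, mul_one_div_cancel hmpos.ne', one_smul]
  rw [hmh] at fin
  refine fin.trans ?_
  have : (m : ℝ) * (c * (r / m) ^ 2) = c / m * r ^ 2 := by field_simp
  rw [this]
  gcongr

/-- symmetric matrix of the quadratic form of T -/
def mat {n : ℕ} (T : En n →L[ℝ] En n) : Mat n := Matrix.of fun i j =>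
  1 / 2 * (inner ℝ (T (EuclideanSpace.single i (1 : ℝ))) (EuclideanSpace.single j (1 : ℝ))
    + inner ℝ (T (EuclideanSpace.single j (1 : ℝ))) (EuclideanSpace.single i (1 : ℝ)))

theorem mat_symm {n : ℕ} (T : En n →L[ℝ] En n) : (mat T).IsSymm := by
  ext i j
  simp only [mat, Matrix.transpose_apply, Matrix.of_apply]
  ring

theorem mat_add {n : ℕ} (T S : En n →L[ℝ] En n) : mat (T + S) = mat T + mat S := by
  ext i j
  simp only [mat, Matrix.of_apply, Matrix.add_apply, _root_.add_apply, inner_add_left]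
  ring

theorem mat_trace {n : ℕ} (T : En n →L[ℝ] En n) : (mat T).trace =
    ∑ i, inner ℝ (T (EuclideanSpace.single i (1 : ℝ))) (EuclideanSpace.single i (1 : ℝ)) := by
  simp only [Matrix.trace, Matrix.diag, mat, Matrix.of_apply]
  refine Finset.sum_congr rfl fun i _ => ?_
  ring

theorem mat_quad {n : ℕ} (T : En n →L[ℝ] En n) (x : Fin n → ℝ) :
    x ⬝ᵥ (mat T).mulVec x = inner ℝ (T (WithLp.toLp 2 x)) (WithLp.toLp 2 x) := by
  have hx : (WithLp.toLp 2 x : En n) = ∑ i, x i • EuclideanSpace.single i (1 : ℝ) := by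
    ext j
    simp [Finset.sum_apply, Pi.single_apply]
  have h1 : inner ℝ (T (WithLp.toLp 2 x)) (WithLp.toLp 2 x : En n) = ∑ i, ∑ j, x i * x j *
      inner ℝ (T (EuclideanSpace.single i (1 : ℝ))) (EuclideanSpace.single j (1 : ℝ)) := by
    rw [hx, map_sum, sum_inner]
    refine Finset.sum_congr rfl fun i _ => ?_
    rw [inner_sum]
    refine Finset.sum_congr rfl fun j _ => ?_
    rw [map_smul, inner_smul_left, inner_smul_right]; simp; ring
  have h2 : ∑ i, ∑ j, x i * x j * inner ℝ (T (EuclideanSpace.single j (1 : ℝ))) (EuclideanSpace.single i (1 : ℝ))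
    = ∑ i, ∑ j, x i * x j *
      inner ℝ (T (EuclideanSpace.single i (1 : ℝ))) (EuclideanSpace.single j (1 : ℝ)) := by
    rw [Finset.sum_comm]
    refine Finset.sum_congr rfl fun i _ => Finset.sum_congr rfl fun j _ => by ring
  rw [h1]
  have h3 : x ⬝ᵥ (mat T).mulVec x = 1 / 2 * (∑ i, ∑ j, x i * x j *
      inner ℝ (T (EuclideanSpace.single i (1 : ℝ))) (EuclideanSpace.single j (1 : ℝ))) + 1 / 2 *
      (∑ i, ∑ j, x i * x j * inner ℝ (T (EuclideanSpace.single j (1 : ℝ))) (EuclideanSpace.single i (1 : ℝ))) := by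
    simp only [dotProduct, Matrix.mulVec, mat, Matrix.of_apply, Finset.mul_sum]
    rw [← Finset.sum_add_distrib]
    refine Finset.sum_congr rfl fun i _ => ?_
    rw [← Finset.sum_add_distrib]
    refine Finset.sum_congr rfl fun j _ => ?_
    ring
  rw [h3, h2]; ring

theorem mat_psd {n : ℕ} (T : En n →L[ℝ] En n) (h : ∀ z, 0 ≤ inner ℝ (T z) z) : (mat T).PosSemidef := by
  refine Matrix.PosSemidef.of_dotProduct_mulVec_nonneg ?_ ?_
  · have := mat_symm T
    rw [Matrix.IsHermitian, Matrix.conjTranspose_eq_transpose_of_trivial]; exact this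
  · intro x
    rw [star_trivial, mat_quad]; exact h _

theorem ell_key {n : ℕ} {lam Lam : ℝ} (hlam : 0 < lam) {F : Mat n → ℝ} (hF : UniformlyElliptic lam Lam F)
    (T₁ T₂ : En n →L[ℝ] En n) (ν : En n) (γ δ : ℝ) (hγ : 0 ≤ γ) (hδ : 0 ≤ δ)
    (h1 : 0 ≤ F (mat (T₁ - δ • ContinuousLinearMap.id ℝ (En n))))
    (h2 : F (mat (δ • ContinuousLinearMap.id ℝ (En n) - T₂)) ≤ 0)
    (h3 : ∀ z, 2 * (inner ℝ ν z) ^ 2 - 2 * γ * ‖z‖ ^ 2 ≤ inner ℝ (T₁ z) z + inner ℝ (T₂ z) z) :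
    lam * ‖ν‖ ^ 2 ≤ n * Lam * (γ + δ) := by
  set I := ContinuousLinearMap.id ℝ (En n) with hI
  set P := T₁ + T₂ + (2 * γ) • I with hP
  have hPz : ∀ z, 2 * (inner ℝ ν z) ^ 2 ≤ inner ℝ (P z) z := by
    intro z
    have := h3 z
    simp only [hP, hI, _root_.add_apply, _root_.smul_apply,
      ContinuousLinearMap.id_apply, inner_add_left, inner_smul_left, real_inner_self_eq_norm_sq, conj_trivial]
    linarith
  have hPpsd := mat_psd P (fun z => le_trans (by positivity) (hPz z))
  have hQpsd := mat_psd ((2 * γ + 2 * δ) • I) (fun z => by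
    simp only [hI, _root_.smul_apply,
      ContinuousLinearMap.id_apply, inner_smul_left, real_inner_self_eq_norm_sq, conj_trivial]
    positivity)
  have tP : 2 * ‖ν‖ ^ 2 ≤ (mat P).trace := by
    rw [mat_trace, EuclideanSpace.real_norm_sq_eq, Finset.mul_sum]
    refine Finset.sum_le_sum fun i _ => ?_
    have := hPz (EuclideanSpace.single i (1 : ℝ))
    rw [EuclideanSpace.inner_single_right] at this
    simpa using this
  have tQ : (mat ((2 * γ + 2 * δ) • I)).trace = n * (2 * γ + 2 * δ) := by
    rw [mat_trace]
    simp [hI, inner_smul_left]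
    ring
  have e : mat (T₁ - δ • I) + mat ((2 * γ + 2 * δ) • I) = mat (δ • I - T₂) + mat P := by
    rw [← mat_add, ← mat_add]
    congr 1
    ext1 z
    simp only [hP, _root_.add_apply, _root_.sub_apply, _root_.smul_apply]
    module
  have a1 := (hF.2 (mat (T₁ - δ • I)) _ (mat_symm _) (mat_symm _) hQpsd).2
  have a2 := (hF.2 (mat (δ • I - T₂)) _ (mat_symm _) (mat_symm _) hPpsd).1
  rw [e, tQ] at a1
  have := mul_le_mul_of_nonneg_left tP hlam.le
  linarith

/-- quadratic-test supersolutions -/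
def SupQ {n : ℕ} (F : Mat n → ℝ) (Ω : Set (En n)) (u : En n → ℝ) : Prop :=
  ∀ x ∈ Ω, ∀ p : En n, ∀ T : En n →L[ℝ] En n,
    (∀ᶠ z in 𝓝 (0 : En n), u x + inner ℝ p z + 1 / 2 * inner ℝ (T z) z ≤ u (x + z)) → 0 ≤ F (mat T)

/-- quadratic-test subsolutions -/
def SubQ {n : ℕ} (F : Mat n → ℝ) (Ω : Set (En n)) (u : En n → ℝ) : Prop :=
  ∀ x ∈ Ω, ∀ p : En n, ∀ T : En n →L[ℝ] En n,
    (∀ᶠ z in 𝓝 (0 : En n), u (x + z) ≤ u x + inner ℝ p z + 1 / 2 * inner ℝ (T z) z) → F (mat T) ≤ 0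

theorem quad_hess {n : ℕ} (c : ℝ) (x p : En n) (T : En n →L[ℝ] En n) :
    ContDiff ℝ 2 (fun z : En n => c + inner ℝ p (z - x) + 1 / 2 * inner ℝ (T (z - x)) (z - x)) ∧
    hessianMatrix (fun z : En n => c + inner ℝ p (z - x) + 1 / 2 * inner ℝ (T (z - x)) (z - x)) x = mat T := by
  constructor
  · have h1 : ContDiff ℝ 2 (fun z : En n => z - x) := by fun_prop
    have h2 : ContDiff ℝ 2 (fun z : En n => T (z - x)) := T.contDiff.comp h1
    exact (contDiff_const.add (contDiff_const.inner ℝ h1)).add (contDiff_const.mul (h2.inner ℝ h1))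
  set φ : En n → ℝ := fun z => c + inner ℝ p (z - x) + 1 / 2 * inner ℝ (T (z - x)) (z - x) with hφ
  set L : En n → En n →L[ℝ] ℝ := fun z => innerSL ℝ p + (1 / 2 : ℝ) • (innerSL ℝ (T (z - x)) +
    (innerSL ℝ (z - x)).comp T) with hL
  have hfd : ∀ z, HasFDerivAt φ (L z) z := by
    intro z
    have h1 : HasFDerivAt (fun z : En n => z - x) (ContinuousLinearMap.id ℝ (En n)) z :=
      (hasFDerivAt_id z).sub_const x
    have h2 : HasFDerivAt (fun z : En n => T (z - x)) (T.comp (ContinuousLinearMap.id ℝ (En n))) z :=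
      T.hasFDerivAt.comp z h1
    have h3 := ((hasFDerivAt_const p z).inner ℝ h1).const_add c
    have h4 := (h2.inner ℝ h1).const_mul (1 / 2 : ℝ)
    refine (h3.add h4).congr_fderiv ?_
    ext y
    simp only [hL]
    have e1 := real_inner_comm (T y) (z - x)
    have e2 := real_inner_comm (T y) z
    have e3 := real_inner_comm (T y) x
    simp [inner_sub_left, inner_sub_right]
    simp only [e2, e3]
    ring
  have hfd' : fderiv ℝ φ = L := by
    ext1 z; exact (hfd z).fderiv
  set D : En n →L[ℝ] En n →L[ℝ] ℝ := (1 / 2 : ℝ) • ((innerSL ℝ).comp T +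
    ((ContinuousLinearMap.compL ℝ (En n) (En n) ℝ).flip T).comp (innerSL ℝ)) with hD
  have hLd : HasFDerivAt L D x := by
    have h1 : HasFDerivAt (fun z : En n => z - x) (ContinuousLinearMap.id ℝ (En n)) x :=
      (hasFDerivAt_id x).sub_const x
    have h2 : HasFDerivAt (fun z : En n => D (z - x)) (D.comp (ContinuousLinearMap.id ℝ (En n))) x :=
      D.hasFDerivAt.comp x h1
    have h3 := h2.const_add (innerSL ℝ p)
    rw [ContinuousLinearMap.comp_id] at h3
    exact h3
  ext i j
  simp only [hessianMatrix, Matrix.of_apply, mat]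
  rw [iteratedFDeriv_two_apply, hfd', hLd.fderiv]
  simp [hD, real_inner_comm]
  ring

theorem visc_sup {n : ℕ} {F : Mat n → ℝ} {Ω : Set (En n)} {u : En n → ℝ}
    (h : ViscSupOn Ω (fun _ _ _ X => F X) u) : SupQ F Ω u := by
  intro x hx p T ht
  obtain ⟨h1, h2⟩ := quad_hess (u x) x p T
  have := h _ h1 x hx ?_
  · simpa only [h2] using this
  · apply Filter.Eventually.filter_mono nhdsWithin_le_nhds
    have ht2 : Filter.Tendsto (fun z : En n => z - x) (𝓝 x) (𝓝 0) := by
      have : ContinuousAt (fun z : En n => z - x) x := by fun_prop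
      rwa [ContinuousAt, sub_self] at this
    filter_upwards [ht2.eventually ht] with z hz
    rw [add_sub_cancel] at hz
    simp only [sub_self, inner_zero_right, mul_zero, add_zero]
    linarith

theorem visc_sub {n : ℕ} {F : Mat n → ℝ} {Ω : Set (En n)} {u : En n → ℝ}
    (h : ViscSubOn Ω (fun _ _ _ X => F X) u) : SubQ F Ω u := by
  intro x hx p T ht
  obtain ⟨h1, h2⟩ := quad_hess (u x) x p T
  have := h _ h1 x hx ?_
  · simpa only [h2] using this
  · apply Filter.Eventually.filter_mono nhdsWithin_le_nhds
    have ht2 : Filter.Tendsto (fun z : En n => z - x) (𝓝 x) (𝓝 0) := by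
      have : ContinuousAt (fun z : En n => z - x) x := by fun_prop
      rwa [ContinuousAt, sub_self] at this
    filter_upwards [ht2.eventually ht] with z hz
    rw [add_sub_cancel] at hz
    simp only [sub_self, inner_zero_right, mul_zero, add_zero]
    linarith

theorem infconv {n : ℕ} (v : En n → ℝ) (x₀ : En n) (ρ ω τ : ℝ) (hρ : 0 < ρ) (hω : 0 < ω) (hτ : 0 < τ)
    (hv : ContinuousOn v (closedBall x₀ ρ)) : ∃ k₀ : ℝ, 0 < k₀ ∧ ∀ k, k₀ ≤ k →
    ∃ (U : En n → ℝ) (X : En n → En n), (∀ ξ, X ξ ∈ closedBall x₀ ρ) ∧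
      (∀ ξ, ∀ y ∈ closedBall x₀ ρ, U ξ ≤ v y + k * ‖y - ξ‖ ^ 2) ∧
      (∀ ξ, U ξ = v (X ξ) + k * ‖X ξ - ξ‖ ^ 2) ∧
      (∀ ξ ∈ closedBall x₀ ρ, v ξ - ω ≤ U ξ) ∧ (∀ ξ ∈ closedBall x₀ ρ, ‖X ξ - ξ‖ ≤ τ) := by
  have hc : IsCompact (closedBall x₀ ρ) := isCompact_closedBall _ _
  obtain ⟨Mb, hMb⟩ := hc.exists_bound_of_continuousOn hv
  have hMb0 : 0 ≤ Mb := (norm_nonneg _).trans (hMb x₀ (mem_closedBall_self hρ.le))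
  have huc := hc.uniformContinuousOn_of_continuous hv
  rw [Metric.uniformContinuousOn_iff_le] at huc
  obtain ⟨τ₁, hτ₁, huc⟩ := huc ω hω
  set τ' := min τ τ₁ with hτ'
  have hτ'0 : 0 < τ' := lt_min hτ hτ₁
  refine ⟨2 * Mb / τ' ^ 2 + 1, by positivity, fun k hk => ?_⟩
  have hk0 : 0 < k := lt_of_lt_of_le (by positivity) hk
  have hex : ∀ ξ, ∃ x ∈ closedBall x₀ ρ, ∀ y ∈ closedBall x₀ ρ,
      v x + k * ‖x - ξ‖ ^ 2 ≤ v y + k * ‖y - ξ‖ ^ 2 := by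
    intro ξ
    obtain ⟨x, hx, hm⟩ := hc.exists_isMinOn ⟨x₀, mem_closedBall_self hρ.le⟩
      (f := fun y => v y + k * ‖y - ξ‖ ^ 2) (hv.add (by fun_prop))
    exact ⟨x, hx, fun y hy => hm hy⟩
  choose X hX hXm using hex
  have hd : ∀ ξ ∈ closedBall x₀ ρ, ‖X ξ - ξ‖ ≤ τ' := by
    intro ξ hξ
    have h1 := hXm ξ ξ hξ
    rw [sub_self, norm_zero] at h1
    have h2 := abs_le.mp (hMb ξ hξ)
    have h3 := abs_le.mp (hMb _ (hX ξ))
    by_contra hlt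
    push Not at hlt
    have h4 : τ' ^ 2 < ‖X ξ - ξ‖ ^ 2 := by gcongr
    have h5 : k * τ' ^ 2 < k * ‖X ξ - ξ‖ ^ 2 := by gcongr
    have h6 : (2 * Mb / τ' ^ 2 + 1) * τ' ^ 2 ≤ k * τ' ^ 2 := by gcongr
    have h7 : (2 * Mb / τ' ^ 2 + 1) * τ' ^ 2 = 2 * Mb + τ' ^ 2 := by field_simp
    have : 0 < τ' ^ 2 := by positivity
    linarith [h2.2, h3.1]
  refine ⟨fun ξ => v (X ξ) + k * ‖X ξ - ξ‖ ^ 2, X, hX, fun ξ y hy => hXm ξ y hy, fun _ => rfl, ?_, ?_⟩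
  · intro ξ hξ
    have h1 := huc (X ξ) (hX ξ) ξ hξ (by rw [dist_eq_norm]; exact (hd ξ hξ).trans (min_le_right _ _))
    rw [Real.dist_eq] at h1
    have := (abs_le.mp h1).1
    have : 0 ≤ k * ‖X ξ - ξ‖ ^ 2 := by positivity
    show v ξ - ω ≤ v (X ξ) + k * ‖X ξ - ξ‖ ^ 2
    linarith
  · intro ξ hξ
    exact (hd ξ hξ).trans (min_le_left _ _)

theorem grad_eq_zero {n : ℕ} (g : En n) (C r : ℝ) (hr : 0 < r)
    (h : ∀ z : En n, ‖z‖ ≤ r → inner ℝ g z ≤ C * ‖z‖ ^ 2) : g = 0 := by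
  by_contra hg
  have hg0 : 0 < ‖g‖ := norm_pos_iff.mpr hg
  set t := min (r / ‖g‖) (1 / (2 * (|C| + 1))) with ht
  have ht0 : 0 < t := lt_min (by positivity) (by positivity)
  have h1 := h (t • g) (by
    rw [norm_smul, Real.norm_of_nonneg ht0.le]
    calc t * ‖g‖ ≤ r / ‖g‖ * ‖g‖ := by gcongr; exact min_le_left _ _
      _ = r := by field_simp)
  rw [inner_smul_right, real_inner_self_eq_norm_sq, norm_smul, Real.norm_of_nonneg ht0.le] at h1
  have h2 : t * (|C| + 1) ≤ 1 / 2 := by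
    calc t * (|C| + 1) ≤ 1 / (2 * (|C| + 1)) * (|C| + 1) := by gcongr; exact min_le_right _ _
      _ = 1 / 2 := by field_simp
  have h3 : t * C ≤ 1 / 2 := by
    have := mul_le_mul_of_nonneg_left (le_abs_self C) ht0.le
    linarith
  have h4 : C * (t * ‖g‖) ^ 2 ≤ t * ‖g‖ ^ 2 * (1 / 2) := by
    have := mul_le_mul_of_nonneg_left h3 (by positivity : 0 ≤ t * ‖g‖ ^ 2)
    linarith
  have : 0 < t * ‖g‖ ^ 2 := by positivity
  linarith

/-- Lipschitz continuity on a ball from semiconcavity. -/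
theorem semiconc_cont {n : ℕ} (U : En n → ℝ) (G : En n → En n) (k N ρ : ℝ) (x₀ : En n) (hk : 0 ≤ k)
    (hU : ∀ ξ z, U (ξ + z) ≤ U ξ + inner ℝ (G ξ) z + k * ‖z‖ ^ 2)
    (hG : ∀ ξ ∈ closedBall x₀ ρ, ‖G ξ‖ ≤ N) : ContinuousOn U (closedBall x₀ ρ) := by
  have key : ∀ ξ ∈ closedBall x₀ ρ, ∀ y ∈ closedBall x₀ ρ, U y - U ξ ≤ (N + k * (2 * ρ)) * ‖y - ξ‖ := by
    intro ξ hξ y hy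
    have h1 := hU ξ (y - ξ)
    rw [add_sub_cancel] at h1
    have h2 : inner ℝ (G ξ) (y - ξ) ≤ N * ‖y - ξ‖ :=
      (real_inner_le_norm _ _).trans (by gcongr; exact hG ξ hξ)
    have h3 : ‖y - ξ‖ ≤ 2 * ρ := by
      rw [← dist_eq_norm]
      have := dist_triangle_right y ξ x₀
      have := mem_closedBall.mp hξ
      have := mem_closedBall.mp hy
      linarith
    have h4 : k * ‖y - ξ‖ ^ 2 ≤ k * (2 * ρ) * ‖y - ξ‖ := by
      have := mul_le_mul_of_nonneg_left h3 (by positivity : 0 ≤ k * ‖y - ξ‖)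
      linarith
    linarith
  have : LipschitzOnWith (Real.toNNReal (N + k * (2 * ρ))) U (closedBall x₀ ρ) := by
    refine LipschitzOnWith.of_dist_le_mul fun ξ hξ y hy => ?_
    rw [Real.dist_eq, dist_eq_norm]
    have h1 := key ξ hξ y hy
    have h2 := key y hy ξ hξ
    rw [norm_sub_rev] at h1
    have h3 : (N + k * (2 * ρ)) * ‖ξ - y‖ ≤ (Real.toNNReal (N + k * (2 * ρ)) : ℝ) * ‖ξ - y‖ := by
      gcongr; exact Real.le_coe_toNNReal _
    rw [abs_le]; constructor <;> linarith
  exact this.continuousOn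

/-- Lipschitz continuity of gradient on the contact set. -/
theorem grad_lip_on {n : ℕ} (f : En n → ℝ) (A : Set (En n)) (G : En n → En n) (C r N : ℝ) (hr : 0 < r) (hC : 0 ≤ C)
    (hf : ∀ a ∈ A, ∀ z : En n, ‖z‖ ≤ r → |f (a + z) - f a - inner ℝ (G a) z| ≤ C * ‖z‖ ^ 2)
    (hG : ∀ a ∈ A, ‖G a‖ ≤ N) : ∃ L : NNReal, LipschitzOnWith L G A := by
  refine ⟨Real.toNNReal (6 * C + 4 * N / r), LipschitzOnWith.of_dist_le_mul fun ξ hξ y hy => ?_⟩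
  have hN : 0 ≤ N := (norm_nonneg _).trans (hG ξ hξ)
  have h0 : 0 ≤ 6 * C + 4 * N / r := by positivity
  rw [Real.coe_toNNReal _ h0, dist_eq_norm, dist_eq_norm]
  have e : 0 ≤ 6 * C * ‖ξ - y‖ := by positivity
  have e2 : 0 ≤ 4 * N / r * ‖ξ - y‖ := by positivity
  rcases le_or_gt ‖ξ - y‖ (r / 2) with h | h
  · have := grad_lip f A G C r hf y ξ hy hξ hC h
    linarith
  · have h1 : ‖G ξ - G y‖ ≤ 2 * N := by
      have := norm_sub_le (G ξ) (G y)
      linarith [hG ξ hξ, hG y hy]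
    have h2 : 4 * N / r * (r / 2) ≤ 4 * N / r * ‖ξ - y‖ := by gcongr
    have h3 : 4 * N / r * (r / 2) = 2 * N := by field_simp; ring
    linarith

theorem Q_expand {n : ℕ} (p ν y z : En n) (γ : ℝ) :
    inner ℝ p (y + z) + (inner ℝ ν (y + z)) ^ 2 - γ * ‖y + z‖ ^ 2 =
    (inner ℝ p y + (inner ℝ ν y) ^ 2 - γ * ‖y‖ ^ 2) +
    inner ℝ (p + (2 * inner ℝ ν y) • ν - (2 * γ) • y) z + (inner ℝ ν z) ^ 2 - γ * ‖z‖ ^ 2 := by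
  rw [norm_add_sq_real, inner_add_right, inner_add_right, inner_sub_left, inner_add_left, inner_smul_left,
    inner_smul_left]
  simp only [conj_trivial]
  ring

set_option maxHeartbeats 1000000 in
theorem jensen {n : ℕ} (U W : En n → ℝ) (G₁ G₂ : En n → En n) (x₀ p ν : En n) (ρ k N γ η : ℝ)
    (hρ : 0 < ρ) (hk : 0 < k) (hγ : 0 ≤ γ) (hη : 0 < η)
    (hU : ∀ ξ z, U (ξ + z) ≤ U ξ + inner ℝ (G₁ ξ) z + k * ‖z‖ ^ 2)
    (hW : ∀ ξ z, W (ξ + z) ≤ W ξ + inner ℝ (G₂ ξ) z + k * ‖z‖ ^ 2)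
    (hG₁ : ∀ ξ ∈ closedBall x₀ ρ, ‖G₁ ξ‖ ≤ N) (hG₂ : ∀ ξ ∈ closedBall x₀ ρ, ‖G₂ ξ‖ ≤ N)
    (hmin : ∀ b : En n, ‖b‖ ≤ η → ∀ ξ ∈ closedBall x₀ ρ,
      (∀ y ∈ closedBall x₀ ρ,
        U ξ + W ξ - (inner ℝ p (ξ - x₀) + (inner ℝ ν (ξ - x₀)) ^ 2 - γ * ‖ξ - x₀‖ ^ 2) - inner ℝ b (ξ - x₀) ≤
        U y + W y - (inner ℝ p (y - x₀) + (inner ℝ ν (y - x₀)) ^ 2 - γ * ‖y - x₀‖ ^ 2) - inner ℝ b (y - x₀)) →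
      ξ ∈ ball x₀ (ρ / 2)) (δ : ℝ) (hδ : 0 < δ) :
    ∃ ξ ∈ ball x₀ (ρ / 2), ∃ T₁ T₂ : En n →L[ℝ] En n,
      (∀ᶠ z in 𝓝 (0 : En n), |U (ξ + z) - U ξ - inner ℝ (G₁ ξ) z - 1 / 2 * inner ℝ (T₁ z) z| ≤ δ * ‖z‖ ^ 2) ∧
      (∀ᶠ z in 𝓝 (0 : En n), |W (ξ + z) - W ξ - inner ℝ (G₂ ξ) z - 1 / 2 * inner ℝ (T₂ z) z| ≤ δ * ‖z‖ ^ 2) ∧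
      ∀ z, 2 * (inner ℝ ν z) ^ 2 - 2 * γ * ‖z‖ ^ 2 ≤ inner ℝ (T₁ z) z + inner ℝ (T₂ z) z := by
  set Ψ : En n → En n → ℝ := fun b y => U y + W y -
    (inner ℝ p (y - x₀) + (inner ℝ ν (y - x₀)) ^ 2 - γ * ‖y - x₀‖ ^ 2) - inner ℝ b (y - x₀) with hΨ
  set DQ : En n → En n := fun ξ => p + (2 * inner ℝ ν (ξ - x₀)) • ν - (2 * γ) • (ξ - x₀) with hDQ
  have hUc := semiconc_cont U G₁ k N ρ x₀ hk.le hU hG₁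
  have hWc := semiconc_cont W G₂ k N ρ x₀ hk.le hW hG₂
  have hex : ∀ b, ∃ ξ ∈ closedBall x₀ ρ, ∀ y ∈ closedBall x₀ ρ, Ψ b ξ ≤ Ψ b y := by
    intro b
    have hcont : ContinuousOn (Ψ b) (closedBall x₀ ρ) :=
      ((hUc.add hWc).sub (by fun_prop)).sub (by fun_prop)
    obtain ⟨x, hx, hm⟩ := (isCompact_closedBall x₀ ρ).exists_isMinOn ⟨x₀, mem_closedBall_self hρ.le⟩ hcont
    exact ⟨x, hx, fun y hy => hm hy⟩
  set A : Set (En n) := {ξ | ξ ∈ ball x₀ (ρ / 2) ∧ ∃ b : En n, ‖b‖ ≤ η ∧ ∀ y ∈ closedBall x₀ ρ, Ψ b ξ ≤ Ψ b y} with hA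
  have hAB : ∀ ξ ∈ A, ξ ∈ closedBall x₀ ρ := fun ξ hξ => by
    have := mem_ball.mp hξ.1
    exact mem_closedBall.mpr (by linarith)
  -- basic inequality
  have hb : ∀ ξ ∈ ball x₀ (ρ / 2), ∀ b : En n, (∀ y ∈ closedBall x₀ ρ, Ψ b ξ ≤ Ψ b y) →
      ∀ z : En n, ‖z‖ ≤ ρ / 2 → inner ℝ (b + DQ ξ) z + (inner ℝ ν z) ^ 2 - γ * ‖z‖ ^ 2 ≤
        U (ξ + z) - U ξ + (W (ξ + z) - W ξ) := by
    intro ξ hξ b hm z hz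
    have hy : ξ + z ∈ closedBall x₀ ρ := by
      rw [mem_closedBall, dist_eq_norm]
      have e : ξ + z - x₀ = (ξ - x₀) + z := by abel
      rw [e]
      have h1 := norm_add_le (ξ - x₀) z
      have h2 := mem_ball.mp hξ
      rw [dist_eq_norm] at h2
      linarith
    have h1 := hm _ hy
    simp only [hΨ] at h1
    have e : ξ + z - x₀ = (ξ - x₀) + z := by abel
    rw [e, Q_expand, inner_add_right b] at h1
    have e2 : inner ℝ (b + DQ ξ) z = inner ℝ b z + inner ℝ (p + (2 * inner ℝ ν (ξ - x₀)) • ν - (2 * γ) • (ξ - x₀)) z := by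
      rw [inner_add_left]
    rw [e2]
    linarith
  have hbG : ∀ ξ ∈ ball x₀ (ρ / 2), ∀ b : En n, (∀ y ∈ closedBall x₀ ρ, Ψ b ξ ≤ Ψ b y) →
      b + DQ ξ = G₁ ξ + G₂ ξ := by
    intro ξ hξ b hm
    have := grad_eq_zero (b + DQ ξ - (G₁ ξ + G₂ ξ)) (γ + 2 * k) (ρ / 2) (by positivity) (fun z hz => by
      have h1 := hb ξ hξ b hm z hz
      have h2 := hU ξ z
      have h3 := hW ξ z
      rw [inner_sub_left, inner_add_left (G₁ ξ)]
      have : 0 ≤ (inner ℝ ν z) ^ 2 := sq_nonneg _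
      linarith)
    exact sub_eq_zero.mp this
  have hAb : ∀ ξ ∈ A, ∀ z : En n, ‖z‖ ≤ ρ / 2 → inner ℝ (G₁ ξ) z + inner ℝ (G₂ ξ) z + (inner ℝ ν z) ^ 2 - γ * ‖z‖ ^ 2 ≤
        U (ξ + z) - U ξ + (W (ξ + z) - W ξ) := by
    rintro ξ ⟨hξ, b, -, hm⟩ z hz
    have h1 := hb ξ hξ b hm z hz
    rw [hbG ξ hξ b hm, inner_add_left] at h1
    exact h1
  have hfU : ∀ a ∈ A, ∀ z : En n, ‖z‖ ≤ ρ / 2 → |U (a + z) - U a - inner ℝ (G₁ a) z| ≤ (γ + k) * ‖z‖ ^ 2 := by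
    intro a ha z hz
    have h1 := hAb a ha z hz
    have h2 := hU a z
    have h3 := hW a z
    have : 0 ≤ (inner ℝ ν z) ^ 2 := sq_nonneg _
    have : 0 ≤ γ * ‖z‖ ^ 2 := by positivity
    rw [abs_le]; constructor <;> linarith
  have hfW : ∀ a ∈ A, ∀ z : En n, ‖z‖ ≤ ρ / 2 → |W (a + z) - W a - inner ℝ (G₂ a) z| ≤ (γ + k) * ‖z‖ ^ 2 := by
    intro a ha z hz
    have h1 := hAb a ha z hz
    have h2 := hU a z
    have h3 := hW a z
    have : 0 ≤ (inner ℝ ν z) ^ 2 := sq_nonneg _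
    have : 0 ≤ γ * ‖z‖ ^ 2 := by positivity
    rw [abs_le]; constructor <;> linarith
  have hC : 0 ≤ γ + k := by positivity
  obtain ⟨L₁, hL₁⟩ := grad_lip_on U A G₁ (γ + k) (ρ / 2) N (by positivity) hC hfU (fun a ha => hG₁ a (hAB a ha))
  obtain ⟨L₂, hL₂⟩ := grad_lip_on W A G₂ (γ + k) (ρ / 2) N (by positivity) hC hfW (fun a ha => hG₂ a (hAB a ha))
  have hL₃ : LipschitzOnWith (Real.toNNReal (2 * ‖ν‖ ^ 2 + 2 * γ)) DQ A := by
    refine LipschitzOnWith.of_dist_le_mul fun ξ _ y _ => ?_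
    rw [Real.coe_toNNReal _ (by positivity), dist_eq_norm, dist_eq_norm]
    have e : DQ ξ - DQ y = (2 * inner ℝ ν (ξ - y)) • ν - (2 * γ) • (ξ - y) := by
      have : inner ℝ ν (ξ - y) = inner ℝ ν (ξ - x₀) - inner ℝ ν (y - x₀) := by
        rw [← inner_sub_right]; congr 1; abel
      rw [this]
      simp only [hDQ]
      module
    rw [e]
    refine (norm_sub_le _ _).trans ?_
    rw [norm_smul, norm_smul, Real.norm_eq_abs, abs_mul, Real.norm_of_nonneg (by positivity : 0 ≤ 2 * γ), abs_two]
    have h1 := abs_real_inner_le_norm ν (ξ - y)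
    have h2 := mul_le_mul_of_nonneg_right h1 (norm_nonneg ν)
    linarith
  have hβ := (hL₁.add hL₂).sub hL₃
  have hvol : volume A ≠ 0 := by
    intro h0
    have h1 := lip_measure _ _ A hβ
    rw [h0, mul_zero] at h1
    have h2 : closedBall (0 : En n) η ⊆ (fun x => G₁ x + G₂ x - DQ x) '' A := by
      intro b hbη
      rw [mem_closedBall_zero_iff] at hbη
      obtain ⟨ξ, hξ, hm⟩ := hex b
      have hξ2 := hmin b hbη ξ hξ hm
      refine ⟨ξ, ⟨hξ2, b, hbη, hm⟩, ?_⟩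
      show G₁ ξ + G₂ ξ - DQ ξ = b
      rw [← hbG ξ hξ2 b hm]; abel
    have h3 := (measure_closedBall_pos volume (0 : En n) hη).trans_le (measure_mono h2)
    exact absurd (lt_of_lt_of_le h3 h1) (lt_irrefl _)
  have hae := (density A).and ((hL₁.ae_differentiableWithinAt_of_mem (μ := volume)).and
    (hL₂.ae_differentiableWithinAt_of_mem (μ := volume)))
  obtain ⟨ξ, hξA, hden, hd₁, hd₂⟩ : ∃ ξ ∈ A, (∀ m : ℕ, 0 < m → ∀ᶠ r in 𝓝[>] (0:ℝ), ∀ p ∈ closedBall ξ r, ∃ a ∈ A, dist a p ≤ r / m) ∧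
      DifferentiableWithinAt ℝ G₁ A ξ ∧ DifferentiableWithinAt ℝ G₂ A ξ := by
    by_contra hno
    push Not at hno
    apply hvol
    refine measure_mono_null ?_ hae
    intro ξ hξ hcon
    exact hno ξ hξ (hcon.1 hξ) (hcon.2.1 hξ) (hcon.2.2 hξ)
  have so₁ := second_order U A G₁ (γ + k) (ρ / 2) hfU hC (by positivity) ξ _ hd₁.hasFDerivWithinAt hden
  have so₂ := second_order W A G₂ (γ + k) (ρ / 2) hfW hC (by positivity) ξ _ hd₂.hasFDerivWithinAt hden
  set T₁ := fderivWithin ℝ G₁ A ξ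
  set T₂ := fderivWithin ℝ G₂ A ξ
  refine ⟨ξ, hξA.1, T₁, T₂, so₁ δ hδ, so₂ δ hδ, fun z => ?_⟩
  apply le_of_forall_pos_le_add
  intro e he
  set δ' := e / (4 * (‖z‖ ^ 2 + 1)) with hδ'
  have hδ'0 : 0 < δ' := by positivity
  have hsm : ∀ᶠ y in 𝓝 (0 : En n), ‖y‖ ≤ ρ / 2 := by
    have : closedBall (0 : En n) (ρ / 2) ∈ 𝓝 (0 : En n) := closedBall_mem_nhds _ (by positivity)
    filter_upwards [this] with y hy
    exact mem_closedBall_zero_iff.mp hy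
  have ht : Filter.Tendsto (fun t : ℝ => t • z) (𝓝[>] 0) (𝓝 0) := by
    have : Continuous (fun t : ℝ => t • z) := by fun_prop
    have h2 := this.tendsto 0
    rw [zero_smul] at h2
    exact h2.mono_left nhdsWithin_le_nhds
  obtain ⟨t, ⟨⟨h1, h2⟩, h3⟩, ht0⟩ := ((ht.eventually ((so₁ δ' hδ'0).and (so₂ δ' hδ'0) |>.and hsm)).and
    self_mem_nhdsWithin).exists
  have ht0 : 0 < t := ht0
  have h4 := hAb ξ hξA (t • z) h3
  have h1 := (abs_le.mp h1).2
  have h2 := (abs_le.mp h2).2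
  rw [map_smul, inner_smul_left, inner_smul_right (T₁ z) z] at h1
  rw [map_smul, inner_smul_left, inner_smul_right (T₂ z) z] at h2
  rw [inner_smul_right ν] at h4
  rw [norm_smul, Real.norm_of_nonneg ht0.le] at h1 h2 h4
  simp only [conj_trivial] at h1 h2
  have h5 : t ^ 2 * ((inner ℝ ν z) ^ 2 - γ * ‖z‖ ^ 2) ≤ t ^ 2 * (1 / 2 * inner ℝ (T₁ z) z + 1 / 2 * inner ℝ (T₂ z) z + 2 * δ' * ‖z‖ ^ 2) := by
    linarith
  have h6 := le_of_mul_le_mul_left h5 (by positivity)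
  have h7 : 4 * δ' * ‖z‖ ^ 2 ≤ e := by
    have : 4 * δ' * (‖z‖ ^ 2 + 1) = e := by rw [hδ']; field_simp
    linarith
  linarith

theorem ic_semi {n : ℕ} (v U : En n → ℝ) (X : En n → En n) (B : Set (En n)) (k : ℝ)
    (hX : ∀ ξ, X ξ ∈ B) (h1 : ∀ ξ, ∀ y ∈ B, U ξ ≤ v y + k * ‖y - ξ‖ ^ 2)
    (h2 : ∀ ξ, U ξ = v (X ξ) + k * ‖X ξ - ξ‖ ^ 2) (ξ z : En n) :
    U (ξ + z) ≤ U ξ + inner ℝ ((2 * k) • (ξ - X ξ)) z + k * ‖z‖ ^ 2 := by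
  have a := h1 (ξ + z) (X ξ) (hX ξ)
  have e : X ξ - (ξ + z) = (X ξ - ξ) - z := by abel
  rw [e, norm_sub_sq_real] at a
  rw [h2 ξ, inner_smul_left, ← neg_sub (X ξ) ξ, inner_neg_left]
  simp only [conj_trivial]
  linarith

theorem ic_touch {n : ℕ} (v U : En n → ℝ) (X : En n → En n) (x₀ : En n) (ρ k δ : ℝ) (G ξ : En n) (T : En n →L[ℝ] En n)
    (h1 : ∀ ξ, ∀ y ∈ closedBall x₀ ρ, U ξ ≤ v y + k * ‖y - ξ‖ ^ 2)
    (h2 : ∀ ξ, U ξ = v (X ξ) + k * ‖X ξ - ξ‖ ^ 2) (hX : X ξ ∈ ball x₀ ρ)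
    (ht : ∀ᶠ z in 𝓝 (0 : En n), |U (ξ + z) - U ξ - inner ℝ G z - 1 / 2 * inner ℝ (T z) z| ≤ δ / 2 * ‖z‖ ^ 2) :
    ∀ᶠ z in 𝓝 (0 : En n), v (X ξ) + inner ℝ G z +
      1 / 2 * inner ℝ ((T - δ • ContinuousLinearMap.id ℝ (En n)) z) z ≤ v (X ξ + z) := by
  have hin : ∀ᶠ z in 𝓝 (0 : En n), X ξ + z ∈ ball x₀ ρ := by
    have hc : ContinuousAt (fun z : En n => X ξ + z) 0 := by fun_prop
    have := isOpen_ball.mem_nhds hX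
    exact hc (by simpa using this)
  filter_upwards [ht, hin] with z hz hz2
  have a := h1 (ξ + z) _ (ball_subset_closedBall hz2)
  have e : X ξ + z - (ξ + z) = X ξ - ξ := by abel
  rw [e] at a
  have b := h2 ξ
  have c := (abs_le.mp hz).1
  rw [_root_.sub_apply, _root_.smul_apply, ContinuousLinearMap.id_apply, inner_sub_left, inner_smul_left,
    real_inner_self_eq_norm_sq]
  simp only [conj_trivial]
  linarith

set_option maxHeartbeats 1000000 in
theorem diff_SupS {n : ℕ} {lam Lam K : ℝ} (hlam : 0 < lam) (hLam : 0 ≤ Lam) (hK : n * Lam ≤ K * lam) {F : Mat n → ℝ}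
    (hF : UniformlyElliptic lam Lam F) {Ω : Set (En n)} (hΩ : IsOpen Ω) {u₁ u₂ : En n → ℝ}
    (hu₁ : SupQ F Ω u₁) (hu₂ : SubQ F Ω u₂) (hc₁ : ContinuousOn u₁ Ω) (hc₂ : ContinuousOn u₂ Ω) :
    SupS K Ω (fun x => u₁ x - u₂ x) := by
  intro x₀ hx₀ p ν γ hγ ht
  have main : ∀ δ : ℝ, 0 < δ → lam * ‖ν‖ ^ 2 ≤ n * Lam * ((γ + δ) + δ) := by
    intro δ hδ
    obtain ⟨ρ, hρ, hB⟩ : ∃ ρ > 0, closedBall x₀ ρ ⊆ Ω ∩ {z | u₁ x₀ - u₂ x₀ + inner ℝ p (z-x₀) + (inner ℝ ν (z-x₀))^2 - γ*‖z-x₀‖^2 ≤ u₁ z - u₂ z} :=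
      Metric.nhds_basis_closedBall.mem_iff.mp (Filter.inter_mem (hΩ.mem_nhds hx₀) ht)
    have hBΩ : closedBall x₀ ρ ⊆ Ω := fun z hz => (hB hz).1
    have hBt : ∀ z ∈ closedBall x₀ ρ, u₁ x₀ - u₂ x₀ + inner ℝ p (z-x₀) + (inner ℝ ν (z-x₀))^2 - γ*‖z-x₀‖^2 ≤ u₁ z - u₂ z :=
      fun z hz => (hB hz).2
    obtain ⟨k₁, hk₁, hi₁⟩ := infconv u₁ x₀ ρ (δ * ρ ^ 2 / 32) (ρ / 8) hρ (by positivity) (by positivity) (hc₁.mono hBΩ)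
    obtain ⟨k₂, hk₂, hi₂⟩ := infconv (fun x => - u₂ x) x₀ ρ (δ * ρ ^ 2 / 32) (ρ / 8) hρ (by positivity) (by positivity) (hc₂.mono hBΩ).neg
    set k := max k₁ k₂
    have hk : 0 < k := lt_of_lt_of_le hk₁ (le_max_left _ _)
    obtain ⟨U, X, hX, hU1, hU2, hU3, hU4⟩ := hi₁ k (le_max_left _ _)
    obtain ⟨W, Y, hY, hW1, hW2, hW3, hW4⟩ := hi₂ k (le_max_right _ _)
    have hx₀B : x₀ ∈ closedBall x₀ ρ := mem_closedBall_self hρ.le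
    have hGb : ∀ X : En n → En n, (∀ ξ ∈ closedBall x₀ ρ, ‖X ξ - ξ‖ ≤ ρ / 8) →
        ∀ ξ ∈ closedBall x₀ ρ, ‖(2 * k) • (ξ - X ξ)‖ ≤ 2 * k * (ρ / 8) := by
      intro X hX ξ hξ
      rw [norm_smul, Real.norm_of_nonneg (by positivity), norm_sub_rev]
      gcongr; exact hX ξ hξ
    obtain ⟨ξ, hξ, T₁, T₂, s1, s2, s3⟩ := jensen U W (fun ξ => (2 * k) • (ξ - X ξ)) (fun ξ => (2 * k) • (ξ - Y ξ)) x₀ p ν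
      ρ k (2 * k * (ρ / 8)) (γ + δ) (δ * ρ / 16) hρ hk (by positivity) (by positivity)
      (ic_semi u₁ U X _ k hX hU1 hU2) (ic_semi _ W Y _ k hY hW1 hW2) (hGb X hU4) (hGb Y hW4) (by
        intro b hb ξ hξ hm
        have a := hm x₀ hx₀B
        simp only [sub_self, inner_zero_right, norm_zero] at a
        have a1 := hU1 x₀ x₀ hx₀B
        have a2 := hW1 x₀ x₀ hx₀B
        simp only [sub_self, norm_zero] at a1 a2
        have a3 := hU3 ξ hξ
        have a4 := hW3 ξ hξ
        have a5 := hBt ξ hξ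
        have hd : ‖ξ - x₀‖ ≤ ρ := by rw [← dist_eq_norm]; exact hξ
        have a6 : inner ℝ b (ξ - x₀) ≤ δ * ρ / 16 * ρ :=
          (real_inner_le_norm _ _).trans (by gcongr)
        have a7 : δ * ‖ξ - x₀‖ ^ 2 ≤ δ * (ρ ^ 2 / 8) := by
          linarith
        have a8 := le_of_mul_le_mul_left a7 hδ
        rw [mem_ball, dist_eq_norm]
        have : 0 < ρ ^ 2 := by positivity
        apply lt_of_pow_lt_pow_left₀ 2 (by positivity)
        linarith) (δ / 2) (by positivity)
    have hmem : ∀ X : En n → En n, (∀ ξ ∈ closedBall x₀ ρ, ‖X ξ - ξ‖ ≤ ρ / 8) → X ξ ∈ ball x₀ ρ := by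
      intro X hX
      have h0 := mem_ball.mp hξ
      have h1 := hX ξ (mem_closedBall.mpr (by linarith))
      rw [← dist_eq_norm] at h1
      rw [mem_ball]
      have := dist_triangle (X ξ) ξ x₀
      linarith
    have hXm := hmem X hU4
    have hYm := hmem Y hW4
    have t1 := hu₁ (X ξ) (hBΩ (ball_subset_closedBall hXm)) _ _ (ic_touch u₁ U X x₀ ρ k δ _ ξ T₁ hU1 hU2 hXm s1)
    have t2 := ic_touch _ W Y x₀ ρ k δ _ ξ T₂ hW1 hW2 hYm s2
    have t3 := hu₂ (Y ξ) (hBΩ (ball_subset_closedBall hYm)) (-((2 * k) • (ξ - Y ξ)))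
      (δ • ContinuousLinearMap.id ℝ (En n) - T₂) (by
        filter_upwards [t2] with z hz
        rw [inner_neg_left, ← neg_sub T₂, _root_.neg_apply, inner_neg_left]
        linarith)
    exact ell_key hlam hF T₁ T₂ ν (γ + δ) δ (by positivity) hδ.le t1 t3 s3
  have h1 : lam * ‖ν‖ ^ 2 ≤ n * Lam * γ := by
    apply le_of_forall_pos_le_add
    intro e he
    have hnL : 0 ≤ n * Lam := by positivity
    have h2 := main (e / (2 * (n * Lam + 1))) (by positivity)
    have h3 : (n * Lam + 1) * (2 * (e / (2 * (n * Lam + 1)))) = e := by field_simp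
    have : 0 < e / (2 * (n * Lam + 1)) := by positivity
    linarith
  have h2 := mul_le_mul_of_nonneg_right hK hγ
  refine le_of_mul_le_mul_left ?_ hlam
  linarith

/-- Hölder estimate for difference quotients -/
def DiffH {n : ℕ} (α : ℝ) (u : En n → ℝ) : Prop :=
  ∀ (x k : En n) (R N : ℝ), 0 < R → 0 ≤ N → ‖x‖ + ‖k‖ + R ≤ 1 →
    (∀ y ∈ ball x R, |u (y + k) - u y| ≤ N) → ∀ z ∈ ball x R,
      |(u (z + k) - u z) - (u (x + k) - u x)| ≤ 6 * N * (‖z - x‖ / R) ^ α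

theorem SupQ.mono {n : ℕ} {F : Mat n → ℝ} {Ω Ω' : Set (En n)} {u : En n → ℝ} (h : SupQ F Ω u) (hs : Ω' ⊆ Ω) : SupQ F Ω' u :=
  fun x hx => h x (hs hx)

theorem SubQ.mono {n : ℕ} {F : Mat n → ℝ} {Ω Ω' : Set (En n)} {u : En n → ℝ} (h : SubQ F Ω u) (hs : Ω' ⊆ Ω) : SubQ F Ω' u :=
  fun x hx => h x (hs hx)

theorem SupQ.shift {n : ℕ} {F : Mat n → ℝ} {Ω Ω' : Set (En n)} {u : En n → ℝ} (h : SupQ F Ω u) (k : En n)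
    (hs : ∀ x ∈ Ω', x + k ∈ Ω) : SupQ F Ω' (fun x => u (x + k)) := by
  intro x hx p T ht
  refine h (x + k) (hs x hx) p T ?_
  filter_upwards [ht] with z hz
  rw [add_right_comm x k z]
  exact hz

theorem SubQ.shift {n : ℕ} {F : Mat n → ℝ} {Ω Ω' : Set (En n)} {u : En n → ℝ} (h : SubQ F Ω u) (k : En n)
    (hs : ∀ x ∈ Ω', x + k ∈ Ω) : SubQ F Ω' (fun x => u (x + k)) := by
  intro x hx p T ht
  refine h (x + k) (hs x hx) p T ?_
  filter_upwards [ht] with z hz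
  rw [add_right_comm x k z]
  exact hz

theorem exists_diffH (n : ℕ) (lam Lam : ℝ) (hlam : 0 < lam) (hLam : 0 ≤ Lam) :
    ∃ α : ℝ, 0 < α ∧ α < 1 ∧ ∀ F : Mat n → ℝ, UniformlyElliptic lam Lam F → ∀ u : En n → ℝ,
      ContinuousOn u (ball 0 1) → SupQ F (ball 0 1) u → SubQ F (ball 0 1) u → DiffH α u := by
  obtain ⟨α, h0, h1, hol⟩ := holder n (K := max 1 (n * Lam / lam)) (le_max_left _ _)
  refine ⟨α, h0, h1, fun F hF u hc hsup hsub => ?_⟩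
  intro x k R N hR hN hxR hb z hz
  have hK : n * Lam ≤ max 1 (n * Lam / lam) * lam := by
    rw [← div_le_iff₀ hlam]; exact le_max_right _ _
  have hin1 : ball x R ⊆ ball (0 : En n) 1 := by
    intro y hy
    rw [mem_ball_zero_iff]
    have := mem_ball_iff_norm.mp hy
    have h2 := norm_add_le (y - x) x
    rw [sub_add_cancel] at h2
    have := norm_nonneg k
    linarith
  have hin2 : ∀ y ∈ ball x R, y + k ∈ ball (0 : En n) 1 := by
    intro y hy
    rw [mem_ball_zero_iff]
    have := mem_ball_iff_norm.mp hy
    have h2 := norm_add_le (y - x) x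
    rw [sub_add_cancel] at h2
    have := norm_add_le y k
    linarith
  have hck : ContinuousOn (fun y => u (y + k)) (ball x R) := hc.comp (by fun_prop) hin2
  have s1 := diff_SupS hlam hLam hK hF isOpen_ball (hsup.shift k hin2) (hsub.mono hin1) hck (hc.mono hin1)
  have s2 := diff_SupS hlam hLam hK hF isOpen_ball (hsup.mono hin1) (hsub.shift k hin2) (hc.mono hin1) hck
  have s3 : SupS (max 1 (n * Lam / lam)) (ball x R) (fun y => -(u (y + k) - u y)) := by
    simpa only [neg_sub] using s2
  set P := (‖z - x‖ / R) ^ α with hP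
  have hP0 : 0 ≤ P := by positivity
  apply le_of_forall_pos_le_add
  intro e he
  set e' := e / (6 * P + 1) with he'
  have he'0 : 0 < e' := by positivity
  have := hol x R (N + e') (fun y => u (y + k) - u y) hR (by positivity) s1 s3 (hck.sub (hc.mono hin1))
    (fun y hy => (hb y hy).trans (by linarith)) z hz
  have h2 : e' * (6 * P + 1) = e := by rw [he']; field_simp
  rw [← hP] at this
  have h3 : 6 * (N + e') * P = 6 * N * P + e' * (6 * P + 1) - e' := by ring
  linarith

theorem telescope {n : ℕ} (u : En n → ℝ) (x k : En n) (m : ℕ) :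
    u (x + (m : ℝ) • k) - u x = ∑ j ∈ Finset.range m, (u (x + (j : ℝ) • k + k) - u (x + (j : ℝ) • k)) := by
  have := Finset.sum_range_sub (fun j : ℕ => u (x + (j : ℝ) • k)) m
  simp only [Nat.cast_zero, zero_smul, add_zero] at this
  rw [← this]
  refine Finset.sum_congr rfl fun j _ => ?_
  have e : x + ((j + 1 : ℕ) : ℝ) • k = x + (j : ℝ) • k + k := by push_cast; module
  rw [e]

theorem telescope_bd {n : ℕ} (u : En n → ℝ) (x k : En n) (m : ℕ) (E : ℝ)
    (h : ∀ j : ℕ, j < m → |(u (x + (j : ℝ) • k + k) - u (x + (j : ℝ) • k)) - (u (x + k) - u x)| ≤ E) :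
    |(u (x + (m : ℝ) • k) - u x) - m * (u (x + k) - u x)| ≤ m * E := by
  rw [telescope]
  have : ∑ j ∈ Finset.range m, (u (x + (j : ℝ) • k + k) - u (x + (j : ℝ) • k)) - m * (u (x + k) - u x)
    = ∑ j ∈ Finset.range m, ((u (x + (j : ℝ) • k + k) - u (x + (j : ℝ) • k)) - (u (x + k) - u x)) := by
    rw [Finset.sum_sub_distrib]; simp; ring
  rw [this]
  refine (Finset.abs_sum_le_sum_abs _ _).trans ?_
  refine (Finset.sum_le_sum (fun j hj => h j (Finset.mem_range.mp hj))).trans ?_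
  simp

set_option maxHeartbeats 1000000 in
theorem lip_step (α : ℝ) (h0 : 0 < α) (h1 : α < 1) : ∃ C : ℝ, 0 < C ∧ ∀ (n : ℕ) (u : En n → ℝ) (M : ℝ), DiffH α u →
    (∀ x ∈ ball (0 : En n) 1, |u x| ≤ M) → ∀ x k : En n, ‖x‖ < 1 → ‖k‖ ≤ (1 - ‖x‖) / 4 →
      (1 - ‖x‖) * |u (x + k) - u x| ≤ C * M * ‖k‖ := by
  set η : ℝ := (1 / 16) ^ (1 / α) with hη
  have hη0 : 0 < η := by positivity
  have hηα : η ^ α = 1 / 16 := by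
    rw [hη, ← Real.rpow_mul (by norm_num)]
    rw [one_div_mul_cancel h0.ne', Real.rpow_one]
  have hη1 : η ≤ 1 / 16 := by
    rw [hη]
    have : (1 : ℝ) ≤ 1 / α := by rw [le_div_iff₀ h0]; linarith
    have := Real.rpow_le_rpow_of_exponent_ge (by norm_num : (0:ℝ) < 1/16) (by norm_num) this
    rwa [Real.rpow_one] at this
  clear_value η
  refine ⟨32 / η, by positivity, fun n u M hD hM x k hx hk => ?_⟩
  have hM0 : 0 ≤ M := (abs_nonneg _).trans (hM 0 (by simp))
  have hM2 : ∀ y k : En n, ‖y‖ + ‖k‖ < 1 → |u (y + k) - u y| ≤ 2 * M := by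
    intro y k hyk
    have a := hM y (by rw [mem_ball_zero_iff]; linarith [norm_nonneg k])
    have b := hM (y + k) (by rw [mem_ball_zero_iff]; linarith [norm_add_le y k])
    have := abs_sub (u (y + k)) (u y)
    linarith
  rcases eq_or_ne k 0 with rfl | hk0
  · simp
  have hkp : 0 < ‖k‖ := norm_pos_iff.mpr hk0
  set S : Set ℝ := {s | ∃ y : En n, ‖y‖ < 1 ∧ ‖k‖ ≤ (1 - ‖y‖) / 4 ∧ s = (1 - ‖y‖) * |u (y + k) - u y|} with hS
  have hbdd : BddAbove S := by
    refine ⟨2 * M, ?_⟩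
    rintro s ⟨y, hy, hyk, rfl⟩
    have a := hM2 y k (by linarith)
    have b : (1 - ‖y‖) * |u (y + k) - u y| ≤ 1 * (2 * M) :=
      mul_le_mul (by linarith [norm_nonneg y]) a (abs_nonneg _) (by norm_num)
    linarith
  have hxS : (1 - ‖x‖) * |u (x + k) - u x| ∈ S := ⟨x, hx, hk, rfl⟩
  set N := sSup S with hN
  have hNub : ∀ y : En n, ‖y‖ < 1 → ‖k‖ ≤ (1 - ‖y‖) / 4 → (1 - ‖y‖) * |u (y + k) - u y| ≤ N :=
    fun y h1 h2 => le_csSup hbdd ⟨y, h1, h2, rfl⟩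
  have hN0 : 0 ≤ N := le_trans (mul_nonneg (by linarith) (abs_nonneg _)) (hNub x hx hk)
  have step : ∀ s ∈ S, s ≤ 16 * M * ‖k‖ / η + N / 2 := by
    rintro s ⟨y, hy, hyk, rfl⟩
    set d := 1 - ‖y‖ with hd
    have hd0 : 0 < d := by linarith
    rcases lt_or_ge (η * d / 4) ‖k‖ with hc | hc
    · have a := hM2 y k (by linarith)
      have b : d * |u (y + k) - u y| ≤ d * (2 * M) := by gcongr
      have c : d ≤ 4 * ‖k‖ / η := by rw [le_div_iff₀ hη0]; linarith
      have e : d * (2 * M) ≤ 4 * ‖k‖ / η * (2 * M) := by gcongr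
      have f : 4 * ‖k‖ / η * (2 * M) = 8 * M * ‖k‖ / η := by ring
      have g : 16 * M * ‖k‖ / η = 2 * (8 * M * ‖k‖ / η) := by ring
      have : 0 ≤ 8 * M * ‖k‖ / η := by positivity
      linarith
    · set q := η * d / (4 * ‖k‖) with hq
      have hq1 : 1 ≤ q := by rw [hq, le_div_iff₀ (by positivity)]; linarith
      set m := ⌊q⌋₊ with hm
      have hm1 : 1 ≤ m := Nat.one_le_floor_iff q |>.mpr hq1
      have hmq : (m : ℝ) ≤ q := Nat.floor_le (by linarith)
      have hqm : q < m + 1 := Nat.lt_floor_add_one q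
      have hm1' : (1 : ℝ) ≤ m := by exact_mod_cast hm1
      have hmk : m * ‖k‖ ≤ η * d / 4 := by
        have : q * ‖k‖ = η * d / 4 := by rw [hq]; field_simp
        rw [← this]; gcongr
      have hmk2 : η * d / 8 ≤ m * ‖k‖ := by
        have : q * ‖k‖ = η * d / 4 := by rw [hq]; field_simp
        have : q * ‖k‖ ≤ (2 * m) * ‖k‖ := by gcongr; linarith
        linarith
      have hηd : η * d ≤ 1 / 16 * d := by gcongr
      have hw : ∀ z ∈ ball y (d / 4), |u (z + k) - u z| ≤ 4 * N / (3 * d) := by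
        intro z hz
        have hz := mem_ball_iff_norm.mp hz
        have h2 := norm_add_le (z - y) y
        rw [sub_add_cancel] at h2
        have h3 : 3 * d / 4 ≤ 1 - ‖z‖ := by linarith
        have h4 := hNub z (by linarith) (by linarith)
        have h5 : 3 * d / 4 * |u (z + k) - u z| ≤ (1 - ‖z‖) * |u (z + k) - u z| := by gcongr
        rw [le_div_iff₀ (by positivity)]
        linarith
      have hol := hD y k (d / 4) (4 * N / (3 * d)) (by positivity) (by positivity) (by linarith) hw
      have tb := telescope_bd u y k m (6 * (4 * N / (3 * d)) * (1 / 16)) (by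
        intro j hj
        have hjm : (j : ℝ) ≤ m := by exact_mod_cast hj.le
        have hjk : ‖(j : ℝ) • k‖ ≤ η * d / 4 := by
          rw [norm_smul, Real.norm_of_nonneg (by positivity)]
          exact le_trans (by gcongr) hmk
        have h5 := hol (y + (j : ℝ) • k) (by
          rw [mem_ball_iff_norm, add_sub_cancel_left]; linarith)
        rw [add_sub_cancel_left] at h5
        refine h5.trans ?_
        rw [← hηα]
        gcongr
        rw [div_le_iff₀ (by positivity)]; linarith)
      have hu := hM2 y ((m : ℝ) • k) (by
        rw [norm_smul, Real.norm_of_nonneg (by positivity)]; linarith)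
      have h6 : m * |u (y + k) - u y| ≤ 2 * M + m * (6 * (4 * N / (3 * d)) * (1 / 16)) := by
        have e : (m : ℝ) * |u (y + k) - u y| = |m * (u (y + k) - u y)| := by
          rw [abs_mul, abs_of_nonneg (by positivity : (0:ℝ) ≤ m)]
        rw [e]
        have := abs_sub (u (y + (m : ℝ) • k) - u y) ((u (y + (m : ℝ) • k) - u y) - m * (u (y + k) - u y))
        rw [sub_sub_cancel] at this
        linarith
      have h7 : 6 * (4 * N / (3 * d)) * (1 / 16) = N / 2 / d := by field_simp; ring
      rw [h7] at h6
      have hm0 : (0:ℝ) < m := by linarith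
      have h8 : m * (d * |u (y + k) - u y|) ≤ m * (16 * M * ‖k‖ / η + N / 2) := by
        have a := mul_le_mul_of_nonneg_left h6 hd0.le
        have b : d * (m * (N / 2 / d)) = m * (N / 2) := by field_simp
        have c : d * (2 * M) ≤ m * (16 * M * ‖k‖ / η) := by
          have c1 := mul_le_mul_of_nonneg_right hmk2 (by positivity : 0 ≤ 16 * M / η)
          have c2 : η * d / 8 * (16 * M / η) = d * (2 * M) := by field_simp; ring
          have c3 : m * ‖k‖ * (16 * M / η) = m * (16 * M * ‖k‖ / η) := by ring
          rw [← c2, ← c3]; exact c1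
        have e : d * (2 * M + m * (N / 2 / d)) = d * (2 * M) + d * (m * (N / 2 / d)) := by ring
        have f : d * (m * |u (y + k) - u y|) = m * (d * |u (y + k) - u y|) := by ring
        rw [mul_add]
        linarith
      exact le_of_mul_le_mul_left h8 hm0
  have hle : N ≤ 16 * M * ‖k‖ / η + N / 2 := csSup_le ⟨_, hxS⟩ step
  have h9 := hNub x hx hk
  have h10 : 32 / η * M * ‖k‖ = 2 * (16 * M * ‖k‖ / η) := by ring
  linarith

theorem rpow_lin {r α : ℝ} (hr : 0 ≤ r) (a0 : 0 < α) (a1 : α < 1) (h : 1 / 8 ≤ r) : 1 ≤ 8 * r ^ α := by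
  have h1 : (1 / 8 : ℝ) ^ (1:ℝ) ≤ (1 / 8 : ℝ) ^ α :=
    Real.rpow_le_rpow_of_exponent_ge (by norm_num) (by norm_num) a1.le
  have h2 : (1 / 8 : ℝ) ^ α ≤ r ^ α := by gcongr
  rw [Real.rpow_one] at h1
  linarith

theorem c1_of_diffH (α : ℝ) (h0 : 0 < α) (h1 : α < 1) : ∃ C : ℝ, 0 < C ∧ ∀ (n : ℕ) (u : En n → ℝ) (M : ℝ),
    DiffH α u → ContinuousOn u (ball 0 1) →
    (∀ x ∈ ball (0 : En n) 1, |u x| ≤ M) → ∃ g : En n → En n, ∀ x ∈ closedBall (0 : En n) (1 / 2),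
      HasGradientAt u (g x) x ∧ ‖g x‖ ≤ C * M ∧ ∀ y ∈ closedBall (0 : En n) (1 / 2), ‖g x - g y‖ ≤ C * M * ‖x - y‖ ^ α := by
  obtain ⟨CL, hCL, hlip⟩ := lip_step α h0 h1
  set C' := 192 * CL with hC'
  have hC'0 : 0 < C' := by positivity
  set C₁ := 4 * CL + 32 with hC₁
  have hC₁0 : 0 < C₁ := by positivity
  refine ⟨3 * C' + 16 * C₁, by positivity, fun n u M hD hc hM => ?_⟩
  have hM0 : 0 ≤ M := (abs_nonneg _).trans (hM 0 (by simp))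
  replace hlip := hlip n u M hD hM
  -- second difference
  have sd : ∀ x k l : En n, ‖x‖ ≤ 5 / 8 → ‖k‖ ≤ 1 / 16 → ‖l‖ < 1 / 8 →
      |(u (x + l + k) - u (x + l)) - (u (x + k) - u x)| ≤ C' * M * ‖k‖ * ‖l‖ ^ α := by
    intro x k l hx hk hl
    have h := hD x k (1 / 8) (4 * CL * M * ‖k‖) (by norm_num) (by positivity) (by linarith) (by
      intro y hy
      have hy := mem_ball_iff_norm.mp hy
      have h2 := norm_add_le (y - x) x
      rw [sub_add_cancel] at h2
      have h3 := hlip y k (by linarith) (by linarith)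
      have h4 : 1 / 4 * |u (y + k) - u y| ≤ (1 - ‖y‖) * |u (y + k) - u y| := by gcongr; linarith
      linarith) (x + l) (by rw [mem_ball_iff_norm, add_sub_cancel_left]; exact hl)
    rw [add_sub_cancel_left] at h
    refine h.trans ?_
    have e : (‖l‖ / (1 / 8)) ^ α ≤ 8 * ‖l‖ ^ α := by
      have : ‖l‖ / (1 / 8) = 8 * ‖l‖ := by ring
      rw [this, Real.mul_rpow (by norm_num) (norm_nonneg _)]
      gcongr
      have := Real.rpow_le_rpow_of_exponent_le (by norm_num : (1:ℝ) ≤ 8) h1.le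
      rwa [Real.rpow_one] at this
    have := mul_le_mul_of_nonneg_left e (by positivity : 0 ≤ 6 * (4 * CL * M * ‖k‖))
    refine this.trans (le_of_eq ?_)
    rw [hC']; ring
  have tel : ∀ x k : En n, ‖x‖ ≤ 5 / 8 → ‖k‖ ≤ 1 / 16 → ∀ m : ℕ, 0 < m →
      |(u (x + k) - u x) - m * (u (x + (1 / m : ℝ) • k) - u x)| ≤ C' * M * ‖k‖ * ‖k‖ ^ α := by
    intro x k hx hk m hm
    have hm0 : (0 : ℝ) < m := by exact_mod_cast hm
    have hm1 : (1 : ℝ) ≤ m := by exact_mod_cast hm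
    have hkm : ‖(1 / m : ℝ) • k‖ = ‖k‖ / m := by
      rw [norm_smul, Real.norm_of_nonneg (by positivity)]; ring
    have tb := telescope_bd u x ((1 / m : ℝ) • k) m (C' * M * (‖k‖ / m) * ‖k‖ ^ α) (by
      intro j hj
      have hjm : (j : ℝ) ≤ m := by exact_mod_cast hj.le
      have hjk : ‖(j : ℝ) • (1 / m : ℝ) • k‖ ≤ ‖k‖ := by
        rw [norm_smul, Real.norm_of_nonneg (by positivity), hkm, mul_div_assoc', div_le_iff₀ hm0, mul_comm]
        gcongr
      have h2 := sd x ((1 / m : ℝ) • k) ((j : ℝ) • (1 / m : ℝ) • k) hx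
        (by rw [hkm]; exact (div_le_self (norm_nonneg _) hm1).trans hk) (by linarith)
      rw [hkm] at h2
      refine h2.trans ?_
      gcongr)
    have e1 : (m : ℝ) • (1 / m : ℝ) • k = k := by
      rw [smul_smul, mul_one_div_cancel hm0.ne', one_smul]
    rw [e1] at tb
    refine tb.trans (le_of_eq ?_)
    field_simp
  -- Lipschitz on the ball of radius 5/8
  have hL : LipschitzOnWith (Real.toNNReal (C₁ * M)) u (ball 0 (5 / 8)) := by
    refine LipschitzOnWith.of_dist_le_mul fun y hy x hx => ?_
    rw [Real.coe_toNNReal _ (by positivity), Real.dist_eq, dist_eq_norm]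
    rw [mem_ball_zero_iff] at hx hy
    have q1 : 0 ≤ CL * M * ‖y - x‖ := by positivity
    have q2 : 0 ≤ M * ‖y - x‖ := by positivity
    rcases le_or_gt ‖y - x‖ (3 / 32) with h | h
    · have h2 := hlip x (y - x) (by linarith) (by linarith)
      rw [add_sub_cancel] at h2
      have h3 : 3 / 8 * |u y - u x| ≤ (1 - ‖x‖) * |u y - u x| := by gcongr; linarith
      rw [hC₁]
      linarith
    · have a := hM y (by rw [mem_ball_zero_iff]; linarith)
      have b := hM x (by rw [mem_ball_zero_iff]; linarith)
      have c := abs_sub (u y) (u x)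
      have d := mul_le_mul_of_nonneg_left h.le hM0
      rw [hC₁]
      linarith
  -- at points of differentiability
  have dpt : ∀ x : En n, x ∈ ball (0 : En n) (5 / 8) → DifferentiableAt ℝ u x → ∃ g : En n, ‖g‖ ≤ C₁ * M ∧
      ∀ k : En n, ‖k‖ ≤ 1 / 16 → |(u (x + k) - u x) - inner ℝ g k| ≤ C' * M * ‖k‖ * ‖k‖ ^ α := by
    intro x hx hd
    have hg := hd.hasGradientAt
    refine ⟨gradient u x, ?_, fun k hk => ?_⟩
    · have := hg.hasFDerivAt.le_of_lipschitzOn (isOpen_ball.mem_nhds hx) hL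
      rw [Real.coe_toNNReal _ (by positivity)] at this
      rwa [LinearIsometryEquiv.norm_map] at this
    · have hlin : Filter.Tendsto (fun m : ℕ => (m : ℝ) * (u (x + (1 / m : ℝ) • k) - u x)) Filter.atTop (𝓝 (inner ℝ (gradient u x) k)) := by
        have := hg.hasFDerivAt.lim_real k
        have h2 := this.comp tendsto_natCast_atTop_atTop
        refine Filter.Tendsto.congr (fun m => ?_) h2
        simp
      have h3 := (tendsto_const_nhds (x := u (x + k) - u x)).sub hlin |>.abs
      rw [mem_ball_zero_iff] at hx
      refine le_of_tendsto h3 ?_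
      filter_upwards [Filter.eventually_gt_atTop 0] with m hm
      exact tel x k hx.le hk m hm
  have hdense : Dense {x : En n | x ∈ ball (0 : En n) (5 / 8) → DifferentiableAt ℝ u x} := by
    apply Measure.dense_of_ae (μ := (volume : Measure (En n)))
    filter_upwards [hL.ae_differentiableWithinAt_of_mem (μ := (volume : Measure (En n)))] with x hx hxb
    exact (hx hxb).differentiableAt (isOpen_ball.mem_nhds hxb)
  have all : ∀ x : En n, x ∈ closedBall (0 : En n) (1 / 2) → ∃ g : En n, ‖g‖ ≤ C₁ * M ∧
      ∀ k : En n, ‖k‖ ≤ 1 / 16 → |(u (x + k) - u x) - inner ℝ g k| ≤ C' * M * ‖k‖ * ‖k‖ ^ α := by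
    intro x hx
    rw [mem_closedBall_zero_iff] at hx
    have hxcl : x ∈ closure {x : En n | x ∈ ball (0 : En n) (5 / 8) → DifferentiableAt ℝ u x} := hdense x
    obtain ⟨xs, hxs, hlim⟩ := mem_closure_iff_seq_limit.mp hxcl
    have hev : ∀ᶠ i in Filter.atTop, xs i ∈ ball (0 : En n) (5 / 8) :=
      hlim (isOpen_ball.mem_nhds (by rw [mem_ball_zero_iff]; linarith))
    obtain ⟨i0, hi0⟩ := Filter.eventually_atTop.mp hev
    have hlim2 : Filter.Tendsto (fun i => xs (i + i0)) Filter.atTop (𝓝 x) := hlim.comp (Filter.tendsto_add_atTop_nat i0)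
    have hex := fun i : ℕ => dpt (xs (i + i0)) (hi0 _ (by omega)) (hxs _ (hi0 _ (by omega)))
    choose g hg1 hg2 using hex
    obtain ⟨G, hG, φ, hφ, hφl⟩ := (isCompact_closedBall (0 : En n) (C₁ * M)).tendsto_subseq
      (fun i => mem_closedBall_zero_iff.mpr (hg1 i))
    refine ⟨G, mem_closedBall_zero_iff.mp hG, fun k hk => ?_⟩
    have hlim3 := hlim2.comp hφ.tendsto_atTop
    have cu : ∀ y : En n, ‖y‖ < 1 → ContinuousAt u y := fun y hy =>
      hc.continuousAt (isOpen_ball.mem_nhds (mem_ball_zero_iff.mpr hy))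
    have t1 := (cu x (by linarith)).tendsto.comp hlim3
    have t2 := (cu (x + k) (by linarith [norm_add_le x k])).tendsto.comp (hlim3.add_const k)
    have t3 := ((t2.sub t1).sub (hφl.inner (tendsto_const_nhds (x := k)))).abs
    exact le_of_tendsto t3 (Filter.Eventually.of_forall fun i => hg2 (φ i) k hk)
  choose! g hg1 hg2 using all
  have hgrad : ∀ x ∈ closedBall (0 : En n) (1 / 2), HasGradientAt u (g x) x := by
    intro x hx
    rw [hasGradientAt_iff_isLittleO_nhds_zero]
    rw [Asymptotics.isLittleO_iff]
    intro c hc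
    have t : Filter.Tendsto (fun k : En n => C' * M * ‖k‖ ^ α) (𝓝 0) (𝓝 0) := by
      have : ContinuousAt (fun k : En n => C' * M * ‖k‖ ^ α) 0 :=
        continuousAt_const.mul (continuous_norm.continuousAt.rpow_const (Or.inr h0.le))
      have h2 := this.tendsto
      simpa [Real.zero_rpow h0.ne'] using h2
    have hsm : closedBall (0 : En n) (1 / 16) ∈ 𝓝 (0 : En n) := closedBall_mem_nhds _ (by norm_num)
    filter_upwards [t.eventually (gt_mem_nhds hc), hsm] with k hk hk2
    have h2 := hg2 x hx k (mem_closedBall_zero_iff.mp hk2)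
    rw [Real.norm_eq_abs]
    refine h2.trans ?_
    have := mul_le_mul_of_nonneg_right hk.le (norm_nonneg k)
    linarith
  refine ⟨g, fun x hx => ⟨hgrad x hx, ?_, fun y hy => ?_⟩⟩
  · have := hg1 x hx
    have : 0 ≤ (3 * C' + 15 * C₁) * M := by positivity
    linarith
  · have q0 : 0 ≤ C' * M * ‖x - y‖ ^ α := by positivity
    have q1 : 0 ≤ C₁ * M * ‖x - y‖ ^ α := by positivity
    rcases lt_or_ge ‖x - y‖ (1 / 8) with h | h
    · rcases eq_or_ne (g x - g y) 0 with hz | hz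
      · rw [hz, norm_zero]; positivity
      rcases eq_or_ne x y with hxy | hxy
      · subst hxy; exact absurd (sub_self _) hz
      have hr : 0 < ‖x - y‖ := norm_pos_iff.mpr (sub_ne_zero.mpr hxy)
      have hgn : 0 < ‖g x - g y‖ := norm_pos_iff.mpr hz
      set k := (‖x - y‖ / 2 / ‖g x - g y‖) • (g x - g y) with hk
      have hkn : ‖k‖ = ‖x - y‖ / 2 := by
        rw [hk, norm_smul, Real.norm_of_nonneg (by positivity)]; field_simp
      have hin : inner ℝ (g x - g y) k = ‖x - y‖ / 2 * ‖g x - g y‖ := by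
        rw [hk, inner_smul_right, real_inner_self_eq_norm_sq]; field_simp
      have a := hg2 x hx k (by linarith)
      have b := hg2 y hy k (by linarith)
      have c := sd y k (x - y) (by linarith [mem_closedBall_zero_iff.mp hy]) (by linarith) h
      rw [add_sub_cancel] at c
      have hka : ‖k‖ ^ α ≤ ‖x - y‖ ^ α := by
        gcongr; linarith
      have hka2 : C' * M * ‖k‖ * ‖k‖ ^ α ≤ C' * M * ‖k‖ * ‖x - y‖ ^ α := by gcongr
      have e : inner ℝ (g x - g y) k ≤ 3 * (C' * M * ‖k‖ * ‖x - y‖ ^ α) := by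
        rw [inner_sub_left]
        linarith [(abs_le.mp a).1, (abs_le.mp b).2, (abs_le.mp c).2]
      rw [hin, hkn] at e
      have f : ‖x - y‖ / 2 * ‖g x - g y‖ ≤ ‖x - y‖ / 2 * (3 * (C' * M * ‖x - y‖ ^ α)) := by linarith
      have := le_of_mul_le_mul_left f (by positivity)
      linarith
    · have a := norm_sub_le (g x) (g y)
      have b := hg1 x hx
      have c := hg1 y hy
      have d := rpow_lin (norm_nonneg _) h0 h1 h
      have e := mul_le_mul_of_nonneg_left d (by positivity : 0 ≤ C₁ * M)
      linarith

/-- Krylov–Safonov regularity — viscosity solutions of the homogeneous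
uniformly elliptic equation `F(D²h) = 0` in `B₁(0)` are `C^{1,α}` in `B̄_{1/2}(0)`, with
`α` and the constant `c` depending only on `n, λ, Λ`. -/
theorem krylov_safonov_C1alpha
    {n : ℕ} (lam Lam : ℝ) (hlam : 0 < lam) (hlL : lam ≤ Lam) :
    ∃ α ∈ Set.Ioo (0:ℝ) 1, ∃ c : ℝ, 0 < c ∧
      ∀ F : Mat n → ℝ, UniformlyElliptic lam Lam F → F 0 = 0 →
      ∀ h : En n → ℝ, ContinuousOn h (ball 0 1) →
        ViscSolOn (ball 0 1) (fun _ _ _ X => F X) h →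
        ∀ M : ℝ, (∀ x ∈ ball (0 : En n) 1, |h x| ≤ M) →
          (∀ x ∈ closedBall (0 : En n) (1/2), DifferentiableAt ℝ h x) ∧
          (∀ x ∈ closedBall (0 : En n) (1/2), |h x| ≤ c * M) ∧
          (∀ x ∈ closedBall (0 : En n) (1/2), ‖gradient h x‖ ≤ c * M) ∧
          (∀ x ∈ closedBall (0 : En n) (1/2), ∀ y ∈ closedBall (0 : En n) (1/2),
            ‖gradient h x - gradient h y‖ ≤ c * M * ‖x - y‖ ^ α) := by
  obtain ⟨α, h0, h1, hα⟩ := exists_diffH n lam Lam hlam (hlam.le.trans hlL)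
  obtain ⟨C, hC, hmain⟩ := c1_of_diffH α h0 h1
  refine ⟨α, ⟨h0, h1⟩, C + 1, by positivity, fun F hF _ h hc hv M hM => ?_⟩
  have hM0 : 0 ≤ M := (abs_nonneg _).trans (hM 0 (by simp))
  obtain ⟨g, hg⟩ := hmain n h M (hα F hF h hc (visc_sup hv.2) (visc_sub hv.1)) hc hM
  refine ⟨fun x hx => (hg x hx).1.differentiableAt, fun x hx => ?_, fun x hx => ?_, fun x hx y hy => ?_⟩
  · have h2 := hM x (closedBall_subset_ball (by norm_num) hx)
    have : 0 ≤ C * M := by positivity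
    linarith
  · rw [(hg x hx).1.gradient]
    have := (hg x hx).2.1
    linarith
  · rw [(hg x hx).1.gradient, (hg y hy).1.gradient]
    have := (hg x hx).2.2 y hy
    have h3 : 0 ≤ M * ‖x - y‖ ^ α := by positivity
    linarith
end
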